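/- Let p be a prime and ψ : ℕ → ℝ a non-negative function with Σ_{n∈ℕ} μ_p(E_n(ψ)) = ∞. If there exists a constant C > 0 such that ψ(n) ≤ C·n^{−2} for all n ∈ ℕ, then μ_p(W_p(ψ)) = 1. -/

import Mathlib

open MeasureTheory Filter

noncomputable section

/-- The set `E_n(ψ) ⊆ ℤ_p`: union over integers `a` with `|a| ≤ n`, `gcd(a,n) = 1`
of the closed balls `{x : |x - a/n|_p ≤ ψ(n)}`. -/
def padicE (p : ℕ) [Fact p.Prime] (ψ : ℕ → ℝ) (n : ℕ) : Set ℤ_[p] :=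
  {x | ∃ a : ℤ, |a| ≤ (n : ℤ) ∧ Int.gcd a n = 1 ∧
    ‖(x : ℚ_[p]) - (a : ℚ_[p]) / (n : ℚ_[p])‖ ≤ ψ n}

/-- `W_p(ψ)`: the points of `ℤ_p` lying in infinitely many of the sets `E_n(ψ)`. -/
def padicW (p : ℕ) [Fact p.Prime] (ψ : ℕ → ℝ) : Set ℤ_[p] :=
  {x | {n : ℕ | x ∈ padicE p ψ n}.Infinite}

/-- The sum of the reciprocals of the prime factors of `n` that exceed `t`. -/
def primeTail (t n : ℕ) : ℝ := ∑ q ∈ n.primeFactors with t < q, (q : ℝ)⁻¹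

theorem inv_one_sub_inv_prime_pos {q : ℕ} (hq : q.Prime) : 0 < (1 - (q : ℝ)⁻¹)⁻¹ := by
  have h : (1 : ℝ) < q := by exact_mod_cast hq.one_lt
  have := inv_lt_one_of_one_lt₀ h
  exact inv_pos.2 (by linarith)

theorem one_le_inv_one_sub_inv_prime {q : ℕ} (hq : q.Prime) : 1 ≤ (1 - (q : ℝ)⁻¹)⁻¹ := by
  have h : (1 : ℝ) < q := by exact_mod_cast hq.one_lt
  have := inv_lt_one_of_one_lt₀ h
  have h0 : (0 : ℝ) < (q : ℝ)⁻¹ := by positivity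
  exact (one_le_inv₀ (by linarith)).2 (by linarith)

theorem inv_prime_le_half {q : ℕ} (hq : q.Prime) : (q : ℝ)⁻¹ ≤ 1 / 2 := by
  have h : (2 : ℝ) ≤ q := by exact_mod_cast hq.two_le
  rw [one_div]
  exact inv_anti₀ (by norm_num) h

theorem inv_one_sub_inv_prime_le_two {q : ℕ} (hq : q.Prime) : (1 - (q : ℝ)⁻¹)⁻¹ ≤ 2 := by
  have := inv_prime_le_half hq
  rw [inv_le_comm₀ (by linarith) (by norm_num)]
  linarith

theorem inv_one_sub_inv_prime_le_exp {q : ℕ} (hq : q.Prime) :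
    (1 - (q : ℝ)⁻¹)⁻¹ ≤ Real.exp (2 * (q : ℝ)⁻¹) := by
  have h2 := inv_prime_le_half hq
  have h0 : (0 : ℝ) ≤ (q : ℝ)⁻¹ := by positivity
  refine le_trans ?_ (Real.add_one_le_exp _)
  rw [inv_le_iff_one_le_mul₀ (by linarith)]
  nlinarith

theorem prod_inv_one_sub_inv_le_exp_primeTail (t n : ℕ) :
    ∏ q ∈ n.primeFactors with t < q, (1 - (q : ℝ)⁻¹)⁻¹ ≤ Real.exp (2 * primeTail t n) := by
  rw [primeTail, Finset.mul_sum, Real.exp_sum]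
  refine Finset.prod_le_prod (fun q hq => ?_) (fun q hq => ?_)
  · exact (inv_one_sub_inv_prime_pos (Nat.prime_of_mem_primeFactors (Finset.mem_filter.1 hq).1)).le
  · exact inv_one_sub_inv_prime_le_exp (Nat.prime_of_mem_primeFactors (Finset.mem_filter.1 hq).1)

theorem totient_mul_prod_inv (n : ℕ) :
    (n.totient : ℝ) * ∏ q ∈ n.primeFactors, (1 - (q : ℝ)⁻¹)⁻¹ = n := by
  have h : (n.totient : ℝ) = n * ∏ q ∈ n.primeFactors, (1 - (q : ℝ)⁻¹) := by
    have h := congrArg (Rat.cast (K := ℝ)) (Nat.totient_eq_mul_prod_factors n)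
    push_cast at h
    exact h
  rw [h, mul_assoc, ← Finset.prod_mul_distrib, Finset.prod_congr rfl (g := fun _ => (1 : ℝ)),
    Finset.prod_const_one, mul_one]
  intro q hq
  have := inv_one_sub_inv_prime_pos (Nat.prime_of_mem_primeFactors hq)
  exact mul_inv_cancel₀ (inv_pos.1 this).ne'

theorem prod_inv_one_sub_inv_le (t n : ℕ) :
    ∏ q ∈ n.primeFactors, (1 - (q : ℝ)⁻¹)⁻¹ ≤ 2 ^ t * Real.exp (2 * primeTail t n) := by
  rw [← Finset.prod_filter_mul_prod_filter_not n.primeFactors (fun q => t < q), mul_comm]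
  refine mul_le_mul ?_ (prod_inv_one_sub_inv_le_exp_primeTail t n) ?_ (by positivity)
  · calc ∏ q ∈ n.primeFactors with ¬ t < q, (1 - (q : ℝ)⁻¹)⁻¹
        ≤ ∏ q ∈ n.primeFactors with ¬ t < q, (2 : ℝ) := by
          refine Finset.prod_le_prod (fun q hq => ?_) (fun q hq => ?_)
          · exact (inv_one_sub_inv_prime_pos
              (Nat.prime_of_mem_primeFactors (Finset.mem_filter.1 hq).1)).le
          · exact inv_one_sub_inv_prime_le_two
              (Nat.prime_of_mem_primeFactors (Finset.mem_filter.1 hq).1)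
      _ = 2 ^ (n.primeFactors.filter (fun q => ¬ t < q)).card := by rw [Finset.prod_const]
      _ ≤ 2 ^ t := by
          refine pow_le_pow_right₀ (by norm_num) ?_
          have : n.primeFactors.filter (fun q => ¬ t < q) ⊆ Finset.Icc 1 t := by
            intro q hq
            rw [Finset.mem_filter] at hq
            exact Finset.mem_Icc.2 ⟨(Nat.prime_of_mem_primeFactors hq.1).one_le, not_lt.1 hq.2⟩
          simpa using Finset.card_le_card this
  · exact Finset.prod_nonneg fun q hq =>
      (inv_one_sub_inv_prime_pos (Nat.prime_of_mem_primeFactors (Finset.mem_filter.1 hq).1)).le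

theorem sum_divisors_inv_le {n : ℕ} (hn : n ≠ 0) :
    ∑ d ∈ n.divisors, (d : ℝ)⁻¹ ≤ ∏ q ∈ n.primeFactors, (1 - (q : ℝ)⁻¹)⁻¹ := by
  have h1 : ∑ d ∈ n.divisors, (d : ℝ)⁻¹ = (∑ d ∈ n.divisors, (d : ℝ)) / n := by
    rw [← Nat.sum_div_divisors n (fun d => (d : ℝ)), Finset.sum_div]
    refine Finset.sum_congr rfl fun d hd => ?_
    have hd' := Nat.dvd_of_mem_divisors hd
    have hd0 : (d : ℝ) ≠ 0 := by exact_mod_cast (Nat.pos_of_mem_divisors hd).ne'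
    have hn0 : (n : ℝ) ≠ 0 := by exact_mod_cast hn
    rw [Nat.cast_div hd' hd0]
    field_simp
  have h2 : (∑ d ∈ n.divisors, (d : ℝ))
      = ∏ q ∈ n.primeFactors, ∑ k ∈ Finset.range (n.factorization q + 1), (q : ℝ) ^ k := by
    rw [← Nat.cast_sum, Nat.sum_divisors hn]
    push_cast
    rfl
  have h3 : (n : ℝ) = ∏ q ∈ n.primeFactors, (q : ℝ) ^ n.factorization q := by
    have h := congrArg (Nat.cast (R := ℝ)) (Nat.prod_factorization_pow_eq_self hn).symm
    rw [Finsupp.prod, Nat.support_factorization] at h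
    push_cast at h
    exact h
  rw [h1, h2, h3, ← Finset.prod_div_distrib]
  refine Finset.prod_le_prod (fun q hq => by positivity) (fun q hq => ?_)
  have hq' := Nat.prime_of_mem_primeFactors hq
  have hq1 : (1 : ℝ) < q := by exact_mod_cast hq'.one_lt
  rw [geom_sum_eq hq1.ne', div_div, div_le_iff₀ (by have : 0 < (q : ℝ) - 1 := by linarith
                                                    positivity)]
  have : (1 - (q : ℝ)⁻¹)⁻¹ = q / (q - 1) := by
    have : (q : ℝ) - 1 ≠ 0 := by linarith
    field_simp
  rw [this]
  have h4 : (q : ℝ) - 1 ≠ 0 := by linarith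
  have : (q : ℝ) / (q - 1) * ((q - 1) * q ^ n.factorization q) = q ^ (n.factorization q + 1) := by
    field_simp
    ring
  rw [this]
  linarith

theorem totient_gcd_mul_le {T n M : ℕ} (hM : M ≠ 0)
    (h : ∀ q, q.Prime → q ∣ n → q ≤ T → q ∣ M) :
    ((n.gcd M).totient : ℝ) * n ≤ n.totient * (n.gcd M) * Real.exp (2 * primeTail T n) := by
  have hg : (n.gcd M) ≠ 0 := Nat.gcd_ne_zero_right hM
  have e1 := totient_mul_prod_inv n
  have e2 := totient_mul_prod_inv (n.gcd M)
  have key : ∏ q ∈ n.primeFactors, (1 - (q : ℝ)⁻¹)⁻¹ ≤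
      (∏ q ∈ (n.gcd M).primeFactors, (1 - (q : ℝ)⁻¹)⁻¹) * Real.exp (2 * primeTail T n) := by
    rw [← Finset.prod_filter_mul_prod_filter_not n.primeFactors (fun q => T < q), mul_comm]
    refine mul_le_mul ?_ (prod_inv_one_sub_inv_le_exp_primeTail T n) ?_ ?_
    · refine Finset.prod_le_prod_of_subset_of_one_le (fun q hq => ?_) (fun q hq => ?_)
        (fun q hq _ => ?_)
      · rw [Finset.mem_filter] at hq
        have hq' := Nat.prime_of_mem_primeFactors hq.1
        have hqn := Nat.dvd_of_mem_primeFactors hq.1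
        exact Nat.mem_primeFactors.2 ⟨hq', Nat.dvd_gcd hqn (h q hq' hqn (not_lt.1 hq.2)), hg⟩
      · exact (inv_one_sub_inv_prime_pos
          (Nat.prime_of_mem_primeFactors (Finset.mem_filter.1 hq).1)).le
      · exact one_le_inv_one_sub_inv_prime (Nat.prime_of_mem_primeFactors hq)
    · exact Finset.prod_nonneg fun q hq =>
        (inv_one_sub_inv_prime_pos (Nat.prime_of_mem_primeFactors (Finset.mem_filter.1 hq).1)).le
    · exact Finset.prod_nonneg fun q hq =>
        (inv_one_sub_inv_prime_pos (Nat.prime_of_mem_primeFactors hq)).le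
  calc ((n.gcd M).totient : ℝ) * n
      = (n.gcd M).totient * (n.totient * ∏ q ∈ n.primeFactors, (1 - (q : ℝ)⁻¹)⁻¹) := by rw [e1]
    _ ≤ (n.gcd M).totient * (n.totient * ((∏ q ∈ (n.gcd M).primeFactors, (1 - (q : ℝ)⁻¹)⁻¹) *
          Real.exp (2 * primeTail T n))) := by gcongr
    _ = n.totient * ((n.gcd M).totient * ∏ q ∈ (n.gcd M).primeFactors, (1 - (q : ℝ)⁻¹)⁻¹) *
          Real.exp (2 * primeTail T n) := by ring
    _ = _ := by rw [e2]

theorem primeTail_mul_le (t : ℕ) {m n : ℕ} (hm : m ≠ 0) (hn : n ≠ 0) :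
    primeTail t (m * n) ≤ primeTail t m + primeTail t n := by
  rw [primeTail, Nat.primeFactors_mul hm hn, Finset.filter_union, primeTail, primeTail,
    ← Finset.sum_union_inter]
  exact le_add_of_nonneg_right (Finset.sum_nonneg fun _ _ => by positivity)

theorem sum_inv_sq_le_one {U : ℕ} {Q : Finset ℕ} (hQ : ∀ q ∈ Q, U < q) :
    ∑ q ∈ Q, (U : ℝ) * ((q : ℝ) ^ 2)⁻¹ ≤ 1 := by
  rcases Nat.eq_zero_or_pos U with rfl | hU
  · simp
  have hsub : Q ⊆ Finset.Ioc U (U + Q.sup id) := fun q hq =>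
    Finset.mem_Ioc.2 ⟨hQ q hq, (Finset.le_sup (f := id) hq).trans (Nat.le_add_left _ _)⟩
  have hU0 : (U : ℝ) ≠ 0 := by exact_mod_cast hU.ne'
  rw [← Finset.mul_sum]
  have h1 : ∑ q ∈ Q, ((q : ℝ) ^ 2)⁻¹ ≤ (U : ℝ)⁻¹ := by
    refine (Finset.sum_le_sum_of_subset_of_nonneg hsub fun _ _ _ => by positivity).trans ?_
    refine (sum_Ioc_inv_sq_le_sub hU.ne' (Nat.le_add_right _ _)).trans ?_
    exact sub_le_self _ (by positivity)
  calc (U : ℝ) * ∑ q ∈ Q, ((q : ℝ) ^ 2)⁻¹ ≤ U * (U : ℝ)⁻¹ := by gcongr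
    _ = 1 := mul_inv_cancel₀ hU0

/-- The constant in the exponential moment bounds for `primeTail`. -/
def momentConst : ℝ := Real.exp (4 * Real.exp 4)

theorem prod_moment_le {U : ℕ} {Q : Finset ℕ} (hQ : ∀ q ∈ Q, U < q) :
    ∏ q ∈ Q, (1 + (Real.exp (4 * U * (q : ℝ)⁻¹) - 1) * (q : ℝ)⁻¹) ≤ momentConst := by
  have hterm : ∀ q ∈ Q, (Real.exp (4 * U * (q : ℝ)⁻¹) - 1) * (q : ℝ)⁻¹ ≤
      4 * Real.exp 4 * (U * ((q : ℝ) ^ 2)⁻¹) := by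
    intro q hq
    have hq0 : (0 : ℝ) < q := by exact_mod_cast (Nat.zero_le U).trans_lt (hQ q hq)
    have hUq : (U : ℝ) ≤ q := by exact_mod_cast (hQ q hq).le
    set x : ℝ := 4 * U * (q : ℝ)⁻¹ with hx
    have hx0 : 0 ≤ x := by positivity
    have hx4 : x ≤ 4 := by
      rw [hx, ← div_eq_mul_inv, div_le_iff₀ hq0]
      linarith
    have h1 : Real.exp x - 1 ≤ x * Real.exp 4 := by
      have h2 : 1 - x ≤ Real.exp (-x) := by linarith [Real.add_one_le_exp (-x)]
      have h3 : Real.exp (-x) * Real.exp x = 1 := by rw [← Real.exp_add]; simp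
      have h4 : Real.exp x ≤ Real.exp 4 := Real.exp_le_exp.2 hx4
      nlinarith [Real.exp_pos x]
    calc (Real.exp x - 1) * (q : ℝ)⁻¹ ≤ x * Real.exp 4 * (q : ℝ)⁻¹ := by gcongr
      _ = 4 * Real.exp 4 * (U * ((q : ℝ) ^ 2)⁻¹) := by rw [hx]; field_simp
  calc ∏ q ∈ Q, (1 + (Real.exp (4 * U * (q : ℝ)⁻¹) - 1) * (q : ℝ)⁻¹)
      ≤ ∏ q ∈ Q, Real.exp (4 * Real.exp 4 * (U * ((q : ℝ) ^ 2)⁻¹)) := by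
        refine Finset.prod_le_prod (fun q hq => ?_) (fun q hq => ?_)
        · have : 1 ≤ Real.exp (4 * U * (q : ℝ)⁻¹) := Real.one_le_exp (by positivity)
          have h0 : (0 : ℝ) ≤ (q : ℝ)⁻¹ := by positivity
          nlinarith
        · have := hterm q hq
          linarith [Real.add_one_le_exp (4 * Real.exp 4 * (U * ((q : ℝ) ^ 2)⁻¹))]
    _ = Real.exp (4 * Real.exp 4 * ∑ q ∈ Q, (U * ((q : ℝ) ^ 2)⁻¹)) := by
        rw [Finset.mul_sum, Real.exp_sum]
    _ ≤ momentConst := by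
        refine Real.exp_le_exp.2 ?_
        have := sum_inv_sq_le_one hQ
        nlinarith [Real.exp_pos 4]

theorem sum_mul_exp_primeTail_le (U : ℕ) {X : Finset ℕ} (hX : ∀ n ∈ X, n ≠ 0) {w : ℕ → ℝ}
    {W : ℝ} (hW : 0 ≤ W)
    (h : ∀ e : ℕ, e ≠ 0 → ∑ n ∈ X with e ∣ n, w n ≤ W * (e : ℝ)⁻¹) :
    ∑ n ∈ X, w n * Real.exp (4 * U * primeTail U n) ≤ W * momentConst := by
  classical
  set Q : Finset ℕ := (X.biUnion Nat.primeFactors).filter (fun q => U < q) with hQ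
  have hQp : ∀ q ∈ Q, q.Prime := by
    intro q hq
    rw [hQ, Finset.mem_filter, Finset.mem_biUnion] at hq
    obtain ⟨⟨n, _, hn⟩, _⟩ := hq
    exact Nat.prime_of_mem_primeFactors hn
  have hQU : ∀ q ∈ Q, U < q := fun q hq => (Finset.mem_filter.1 hq).2
  set f : ℕ → ℝ := fun q => Real.exp (4 * U * (q : ℝ)⁻¹) - 1 with hf
  have hf0 : ∀ q, 0 ≤ f q := fun q => by
    have : 1 ≤ Real.exp (4 * U * (q : ℝ)⁻¹) := Real.one_le_exp (by positivity)
    simp only [hf]; linarith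
  have hexp : ∀ n ∈ X, Real.exp (4 * U * primeTail U n) =
      ∑ A ∈ Q.powerset, if (∏ q ∈ A, q) ∣ n then ∏ q ∈ A, f q else 0 := by
    intro n hn
    have hfil : n.primeFactors.filter (fun q => U < q) = Q.filter (fun q => q ∣ n) := by
      ext q
      simp only [hQ, Finset.mem_filter, Finset.mem_biUnion]
      constructor
      · rintro ⟨h1, h2⟩
        exact ⟨⟨⟨n, hn, h1⟩, h2⟩, Nat.dvd_of_mem_primeFactors h1⟩
      · rintro ⟨⟨⟨k, _, h1⟩, h2⟩, h3⟩
        exact ⟨Nat.mem_primeFactors.2 ⟨Nat.prime_of_mem_primeFactors h1, h3, hX n hn⟩, h2⟩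
    rw [primeTail, Finset.mul_sum, Real.exp_sum, hfil]
    have : ∏ q ∈ Q with q ∣ n, Real.exp (4 * U * (q : ℝ)⁻¹) = ∏ q ∈ Q with q ∣ n, (1 + f q) :=
      Finset.prod_congr rfl fun q _ => by simp [hf]
    rw [this, Finset.prod_one_add, ← Finset.sum_filter]
    refine Finset.sum_congr ?_ fun _ _ => rfl
    ext A
    simp only [Finset.mem_powerset, Finset.mem_filter]
    constructor
    · intro hA
      refine ⟨hA.trans (Finset.filter_subset _ _), Finset.prod_primes_dvd n ?_ ?_⟩
      · exact fun q hq => (hQp q (Finset.filter_subset _ _ (hA hq))).prime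
      · exact fun q hq => (Finset.mem_filter.1 (hA hq)).2
    · rintro ⟨hA, hd⟩ q hq
      exact Finset.mem_filter.2 ⟨hA hq, (Finset.dvd_prod_of_mem (fun q => q) hq).trans hd⟩
  calc ∑ n ∈ X, w n * Real.exp (4 * U * primeTail U n)
      = ∑ n ∈ X, ∑ A ∈ Q.powerset,
          (if (∏ q ∈ A, q) ∣ n then w n * ∏ q ∈ A, f q else 0) := by
        refine Finset.sum_congr rfl fun n hn => ?_
        rw [hexp n hn, Finset.mul_sum]
        exact Finset.sum_congr rfl fun A _ => by split_ifs <;> simp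
    _ = ∑ A ∈ Q.powerset, (∏ q ∈ A, f q) * ∑ n ∈ X with (∏ q ∈ A, q) ∣ n, w n := by
        rw [Finset.sum_comm]
        refine Finset.sum_congr rfl fun A _ => ?_
        rw [← Finset.sum_filter, Finset.mul_sum]
        exact Finset.sum_congr rfl fun n _ => mul_comm _ _
    _ ≤ ∑ A ∈ Q.powerset, (∏ q ∈ A, f q) * (W * ∏ q ∈ A, (q : ℝ)⁻¹) := by
        refine Finset.sum_le_sum fun A hA => ?_
        refine mul_le_mul_of_nonneg_left ?_ (Finset.prod_nonneg fun q _ => hf0 q)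
        have := h (∏ q ∈ A, q) (Finset.prod_ne_zero_iff.2 fun q hq =>
          (hQp q (Finset.mem_powerset.1 hA hq)).ne_zero)
        simpa [Finset.prod_inv_distrib] using this
    _ = W * ∏ q ∈ Q, (1 + f q * (q : ℝ)⁻¹) := by
        rw [Finset.prod_one_add, Finset.mul_sum]
        refine Finset.sum_congr rfl fun A _ => ?_
        rw [Finset.prod_mul_distrib]
        ring
    _ ≤ W * momentConst := mul_le_mul_of_nonneg_left (prod_moment_le hQU) hW

theorem sum_Icc_exp_primeTail_le (U Y : ℕ) :
    ∑ n ∈ Finset.Icc 1 Y, Real.exp (4 * U * primeTail U n) ≤ Y * momentConst := by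
  have := sum_mul_exp_primeTail_le U (X := Finset.Icc 1 Y) (w := fun _ => 1) (W := Y)
    (fun n hn => (Finset.mem_Icc.1 hn).1.trans_lt' zero_lt_one |>.ne') (by positivity) ?_
  · simpa using this
  · intro e he
    have hcard : ((Finset.Icc 1 Y).filter (fun n => e ∣ n)).card = Y / e := by
      rw [← Nat.Ioc_filter_dvd_card_eq_div Y e]
      rfl
    rw [Finset.sum_const, hcard, nsmul_eq_mul, mul_one, ← div_eq_mul_inv]
    exact Nat.cast_div_le

theorem sum_divisors_exp_primeTail_le (U : ℕ) {m : ℕ} (hm : m ≠ 0) :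
    ∑ d ∈ m.divisors, (d : ℝ)⁻¹ * Real.exp (4 * U * primeTail U d) ≤
      (∑ d ∈ m.divisors, (d : ℝ)⁻¹) * momentConst := by
  refine sum_mul_exp_primeTail_le U (fun n hn => (Nat.pos_of_mem_divisors hn).ne')
    (Finset.sum_nonneg fun _ _ => by positivity) ?_
  intro e he
  have hinj : Set.InjOn (fun d => d / e) (m.divisors.filter (fun d => e ∣ d) : Finset ℕ) := by
    intro x hx y hy hxy
    have hx' := (Finset.mem_filter.1 hx).2
    have hy' := (Finset.mem_filter.1 hy).2
    rw [← Nat.div_mul_cancel hx', ← Nat.div_mul_cancel hy']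
    exact congrArg (· * e) hxy
  calc ∑ d ∈ m.divisors with e ∣ d, (d : ℝ)⁻¹
      = ∑ d ∈ m.divisors with e ∣ d, ((d / e : ℕ) : ℝ)⁻¹ * (e : ℝ)⁻¹ := by
        refine Finset.sum_congr rfl fun d hd => ?_
        have he' : (e : ℝ) ≠ 0 := by exact_mod_cast he
        rw [Nat.cast_div (Finset.mem_filter.1 hd).2 he', ← mul_inv, div_mul_cancel₀ _ he']
    _ = (∑ d ∈ (m.divisors.filter (fun d => e ∣ d)).image (fun d => d / e), (d : ℝ)⁻¹) *
          (e : ℝ)⁻¹ := by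
        rw [Finset.sum_image hinj, Finset.sum_mul]
    _ ≤ (∑ d ∈ m.divisors, (d : ℝ)⁻¹) * (e : ℝ)⁻¹ := by
        refine mul_le_mul_of_nonneg_right ?_ (by positivity)
        refine Finset.sum_le_sum_of_subset_of_nonneg ?_ fun _ _ _ => by positivity
        intro x hx
        obtain ⟨d, hd, rfl⟩ := Finset.mem_image.1 hx
        rw [Finset.mem_filter, Nat.mem_divisors] at hd
        exact Nat.mem_divisors.2 ⟨(Nat.div_dvd_of_dvd hd.2).trans hd.1.1, hm⟩

theorem primeTail_anti {s t : ℕ} (h : s ≤ t) (n : ℕ) : primeTail t n ≤ primeTail s n :=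
  Finset.sum_le_sum_of_subset_of_nonneg
    (Finset.monotone_filter_right _ fun _ _ hq => h.trans_lt hq) fun _ _ _ => by positivity

theorem exists_primeTail_le_one (n : ℕ) : ∃ t, primeTail t n ≤ 1 := by
  refine ⟨n, ?_⟩
  rw [primeTail, Finset.filter_false_of_mem, Finset.sum_empty]
  · exact zero_le_one
  · exact fun q hq => not_lt.2 (Nat.le_of_mem_primeFactors hq)

open Classical in
/-- The least `t` such that the reciprocals of the prime factors of `n` beyond `t` add up to at
most `1`. -/
def cutoff (n : ℕ) : ℕ := Nat.find (exists_primeTail_le_one n)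

theorem primeTail_le_one {n T : ℕ} (h : cutoff n ≤ T) : primeTail T n ≤ 1 := by
  classical
  exact (primeTail_anti h n).trans (Nat.find_spec (exists_primeTail_le_one n))

theorem one_lt_primeTail {n U : ℕ} (h : U < cutoff n) : 1 < primeTail U n := by
  classical
  exact not_le.1 (Nat.find_min (exists_primeTail_le_one n) h)

theorem one_le_exp_primeTail (n : ℕ) :
    1 ≤ Real.exp (-(4 * (cutoff n - 1 : ℕ))) *
      Real.exp (4 * (cutoff n - 1 : ℕ) * primeTail (cutoff n - 1) n) := by
  rw [← Real.exp_add]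
  refine Real.one_le_exp ?_
  rcases Nat.eq_zero_or_pos (cutoff n) with h | h
  · simp [h]
  · have h1 := one_lt_primeTail (Nat.sub_lt h one_pos)
    have h2 : (0 : ℝ) ≤ ((cutoff n - 1 : ℕ) : ℝ) := by positivity
    nlinarith

theorem sum_gcd_le {m T : ℕ} (hm : m ≠ 0) {A : Finset ℕ} (hA0 : ∀ n ∈ A, n ≠ 0)
    (hA : ∀ n ∈ A, cutoff n = T) {V Y : ℕ → ℝ} {Z : ℝ} (hV : ∀ d, 0 ≤ V d) (hY0 : ∀ d, 0 ≤ Y d)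
    (hY : ∀ n ∈ A, ((n / n.gcd m : ℕ) : ℝ) ≤ Y (n.gcd m))
    (hVY : ∀ d ∈ m.divisors, V d * Y d ≤ Z * (d : ℝ)⁻¹) (hZ : 0 ≤ Z) :
    ∑ n ∈ A, V (n.gcd m) ≤
      Z * (Real.exp (-(4 * (T - 1 : ℕ))) * momentConst ^ 2 * ∑ d ∈ m.divisors, (d : ℝ)⁻¹) := by
  set U : ℕ := T - 1 with hU
  set E : ℝ := Real.exp (-(4 * (U : ℝ))) with hE
  have hE0 : 0 < E := Real.exp_pos _
  have hK0 : 0 < momentConst := Real.exp_pos _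
  have hmaps : ∀ n ∈ A, n.gcd m ∈ m.divisors := fun n _ =>
    Nat.mem_divisors.2 ⟨Nat.gcd_dvd_right n m, hm⟩
  rw [← Finset.sum_fiberwise_of_maps_to hmaps]
  have hfib : ∀ d ∈ m.divisors, ∑ n ∈ A with n.gcd m = d, V (n.gcd m) ≤
      Z * E * momentConst * ((d : ℝ)⁻¹ * Real.exp (4 * U * primeTail U d)) := by
    intro d hd
    have hd0 : d ≠ 0 := (Nat.pos_of_mem_divisors hd).ne'
    set B := A.filter (fun n => n.gcd m = d) with hB
    have hinj : Set.InjOn (fun n => n / d) (B : Set ℕ) := by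
      intro x hx y hy hxy
      have hx' : d ∣ x := (Finset.mem_filter.1 hx).2 ▸ Nat.gcd_dvd_left x m
      have hy' : d ∣ y := (Finset.mem_filter.1 hy).2 ▸ Nat.gcd_dvd_left y m
      rw [← Nat.div_mul_cancel hx', ← Nat.div_mul_cancel hy']
      exact congrArg (· * d) hxy
    have hterm : ∀ n ∈ B, (1 : ℝ) ≤ E * Real.exp (4 * U * primeTail U d) *
        Real.exp (4 * U * primeTail U (n / d)) := by
      intro n hn
      rw [hB, Finset.mem_filter] at hn
      have hdn : d ∣ n := hn.2 ▸ Nat.gcd_dvd_left n m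
      have hnd : n / d ≠ 0 := (Nat.div_pos (Nat.le_of_dvd (Nat.pos_of_ne_zero (hA0 n hn.1)) hdn)
        (Nat.pos_of_ne_zero hd0)).ne'
      have h1 := one_le_exp_primeTail n
      rw [hA n hn.1, ← hU, ← hE] at h1
      refine h1.trans ?_
      rw [mul_assoc E, ← Real.exp_add (4 * U * primeTail U d), ← mul_add]
      refine mul_le_mul_of_nonneg_left (Real.exp_le_exp.2 ?_) hE0.le
      refine mul_le_mul_of_nonneg_left ?_ (by positivity)
      have := primeTail_mul_le U hd0 hnd
      rwa [Nat.mul_div_cancel' hdn] at this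
    have hcount : (B.card : ℝ) ≤ E * Real.exp (4 * U * primeTail U d) * (Y d * momentConst) := by
      calc (B.card : ℝ) = ∑ n ∈ B, (1 : ℝ) := by simp
        _ ≤ ∑ n ∈ B, E * Real.exp (4 * U * primeTail U d) *
              Real.exp (4 * U * primeTail U (n / d)) := Finset.sum_le_sum hterm
        _ = E * Real.exp (4 * U * primeTail U d) *
              ∑ k ∈ B.image (fun n => n / d), Real.exp (4 * U * primeTail U k) := by
            rw [Finset.sum_image hinj, Finset.mul_sum]
        _ ≤ E * Real.exp (4 * U * primeTail U d) *
              ∑ k ∈ Finset.Icc 1 ⌊Y d⌋₊, Real.exp (4 * U * primeTail U k) := by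
            refine mul_le_mul_of_nonneg_left ?_ (by positivity)
            refine Finset.sum_le_sum_of_subset_of_nonneg ?_ fun _ _ _ => (Real.exp_pos _).le
            intro k hk
            obtain ⟨n, hn, rfl⟩ := Finset.mem_image.1 hk
            rw [hB, Finset.mem_filter] at hn
            have hdn : d ∣ n := hn.2 ▸ Nat.gcd_dvd_left n m
            have hYn := hY n hn.1
            rw [hn.2] at hYn
            exact Finset.mem_Icc.2 ⟨Nat.div_pos (Nat.le_of_dvd
              (Nat.pos_of_ne_zero (hA0 n hn.1)) hdn) (Nat.pos_of_ne_zero hd0), Nat.le_floor hYn⟩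
        _ ≤ E * Real.exp (4 * U * primeTail U d) * (Y d * momentConst) := by
            refine mul_le_mul_of_nonneg_left ?_ (by positivity)
            refine (sum_Icc_exp_primeTail_le U _).trans ?_
            exact mul_le_mul_of_nonneg_right (Nat.floor_le (hY0 d)) hK0.le
    calc ∑ n ∈ B, V (n.gcd m) = B.card * V d := by
          rw [Finset.sum_congr rfl (g := fun _ => V d), Finset.sum_const, nsmul_eq_mul]
          exact fun n hn => by rw [(Finset.mem_filter.1 hn).2]
      _ ≤ E * Real.exp (4 * U * primeTail U d) * (Y d * momentConst) * V d :=
          mul_le_mul_of_nonneg_right hcount (hV d)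
      _ = (V d * Y d) * (E * momentConst * Real.exp (4 * U * primeTail U d)) := by ring
      _ ≤ (Z * (d : ℝ)⁻¹) * (E * momentConst * Real.exp (4 * U * primeTail U d)) :=
          mul_le_mul_of_nonneg_right (hVY d hd) (by positivity)
      _ = _ := by ring
  refine (Finset.sum_le_sum hfib).trans ?_
  rw [← Finset.mul_sum]
  calc Z * E * momentConst * ∑ d ∈ m.divisors, (d : ℝ)⁻¹ * Real.exp (4 * U * primeTail U d)
      ≤ Z * E * momentConst * ((∑ d ∈ m.divisors, (d : ℝ)⁻¹) * momentConst) :=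
        mul_le_mul_of_nonneg_left (sum_divisors_exp_primeTail_le U hm) (by positivity)
    _ = _ := by ring

/-- The constant in the bound for the sum over pairs with small overlap modulus. -/
def sparseConst : ℝ := 32 * Real.exp 4 * momentConst ^ 2

theorem sixteen_pow_mul_exp_le (T : ℕ) :
    (16 : ℝ) ^ T * Real.exp (-(4 * (T - 1 : ℕ))) ≤ 32 * (1 / 2) ^ T := by
  rcases T with _ | U
  · norm_num
  · have h32 : (32 : ℝ) ≤ Real.exp 4 := by
      have h1 := Real.exp_one_gt_d9
      have h2 : Real.exp 4 = Real.exp 1 ^ 4 := by rw [← Real.exp_nat_mul]; norm_num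
      rw [h2]
      calc (32 : ℝ) ≤ 2.7 ^ 4 := by norm_num
        _ ≤ Real.exp 1 ^ 4 := by gcongr; linarith
    have h3 : Real.exp (-(4 * (U : ℝ))) = (Real.exp 4 ^ U)⁻¹ := by
      rw [Real.exp_neg, ← Real.exp_nat_mul, mul_comm]
    rw [Nat.add_sub_cancel, h3, ← div_eq_mul_inv, div_le_iff₀ (by positivity)]
    calc (16 : ℝ) ^ (U + 1) = 32 * (1 / 2) ^ (U + 1) * 32 ^ U := by
          rw [pow_succ, pow_succ, show (16 : ℝ) = 1 / 2 * 32 by norm_num, mul_pow]; ring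
      _ ≤ 32 * (1 / 2) ^ (U + 1) * Real.exp 4 ^ U := by gcongr

theorem sum_gcd_le_totient {m T : ℕ} (hm : m ≠ 0) (hmT : cutoff m ≤ T) {A : Finset ℕ}
    (hA0 : ∀ n ∈ A, n ≠ 0) (hA : ∀ n ∈ A, cutoff n = T) {V Y : ℕ → ℝ} {z : ℝ} (hV : ∀ d, 0 ≤ V d)
    (hY0 : ∀ d, 0 ≤ Y d) (hY : ∀ n ∈ A, ((n / n.gcd m : ℕ) : ℝ) ≤ Y (n.gcd m))
    (hVY : ∀ d ∈ m.divisors, V d * Y d ≤ z * m * 4 ^ T * (d : ℝ)⁻¹) (hz : 0 ≤ z) :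
    ∑ n ∈ A, V (n.gcd m) ≤ z * m.totient * sparseConst * (1 / 2) ^ T := by
  refine (sum_gcd_le hm hA0 hA hV hY0 hY hVY (by positivity)).trans ?_
  set P : ℝ := ∏ q ∈ m.primeFactors, (1 - (q : ℝ)⁻¹)⁻¹ with hP
  have hP0 : 0 ≤ P := Finset.prod_nonneg fun q hq =>
    (inv_one_sub_inv_prime_pos (Nat.prime_of_mem_primeFactors hq)).le
  have hPle : P ≤ 2 ^ T * Real.exp 2 := by
    refine (prod_inv_one_sub_inv_le T m).trans ?_
    gcongr
    linarith [primeTail_le_one hmT]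
  have hK0 : 0 < momentConst := Real.exp_pos _
  calc z * m * 4 ^ T * (Real.exp (-(4 * (T - 1 : ℕ))) * momentConst ^ 2 *
        ∑ d ∈ m.divisors, (d : ℝ)⁻¹)
      ≤ z * (m.totient * P) * 4 ^ T * (Real.exp (-(4 * (T - 1 : ℕ))) * momentConst ^ 2 * P) := by
        rw [totient_mul_prod_inv]
        gcongr
        exact sum_divisors_inv_le hm
    _ = z * m.totient * 4 ^ T * (Real.exp (-(4 * (T - 1 : ℕ))) * momentConst ^ 2) * P ^ 2 := by
        ring
    _ ≤ z * m.totient * 4 ^ T * (Real.exp (-(4 * (T - 1 : ℕ))) * momentConst ^ 2) *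
          (2 ^ T * Real.exp 2) ^ 2 := by gcongr
    _ = z * m.totient * (momentConst ^ 2 * Real.exp 4) *
          (16 ^ T * Real.exp (-(4 * (T - 1 : ℕ)))) := by
        have h1 : Real.exp 4 = Real.exp 2 ^ 2 := by rw [← Real.exp_nat_mul]; norm_num
        have h2 : (16 : ℝ) ^ T = 4 ^ T * (2 ^ T) ^ 2 := by
          rw [← pow_mul, mul_comm T 2, pow_mul, ← mul_pow]; norm_num
        rw [h1, h2]; ring
    _ ≤ z * m.totient * (momentConst ^ 2 * Real.exp 4) * (32 * (1 / 2) ^ T) := by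
        have := sixteen_pow_mul_exp_le T
        gcongr
    _ = _ := by rw [sparseConst]; ring

theorem card_le_of_congruent {S : Finset ℤ} {lo : ℤ} {q t : ℕ} (hq : 0 < q)
    (hS : ∀ x ∈ S, lo ≤ x ∧ x < lo + q * t) (h : ∀ x ∈ S, ∀ y ∈ S, (q : ℤ) ∣ x - y) :
    S.card ≤ t := by
  have hq' : (0 : ℤ) < q := by exact_mod_cast hq
  rw [← Finset.card_range t]
  refine Finset.card_le_card_of_injOn (fun x => ((x - lo) / q).toNat) ?_ ?_
  · intro x hx
    have h1 := hS x hx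
    have h2 : (x - lo) / q < t := Int.ediv_lt_of_lt_mul hq' (by linarith)
    have h3 : 0 ≤ (x - lo) / q := Int.ediv_nonneg (by linarith) hq'.le
    simp only [Finset.coe_range, Set.mem_Iio]
    omega
  · intro x hx y hy hxy
    have h1 : 0 ≤ (x - lo) / q := Int.ediv_nonneg (by linarith [(hS x hx).1]) hq'.le
    have h2 : 0 ≤ (y - lo) / q := Int.ediv_nonneg (by linarith [(hS y hy).1]) hq'.le
    have h3 : (x - lo) / q = (y - lo) / q := by
      simp only at hxy
      omega
    have h4 : (x - lo) % q = (y - lo) % q :=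
      Int.ModEq.symm (Int.modEq_iff_dvd.2 (by simpa using h x hx y hy))
    have h5 := Int.mul_ediv_add_emod (x - lo) q
    have h6 := Int.mul_ediv_add_emod (y - lo) q
    rw [h3, h4] at h5
    linarith

/-- The pairs of reduced numerators `a / n`, `b / m` in `[0, 1)` that are congruent modulo `K`. -/
def closePairs (n m K : ℕ) : Finset (ℕ × ℕ) :=
  (Finset.range n ×ˢ Finset.range m).filter fun x =>
    n.Coprime x.1 ∧ m.Coprime x.2 ∧ (K : ℤ) ∣ x.1 * m - x.2 * n

theorem mem_closePairs {n m K a b : ℕ} : (a, b) ∈ closePairs n m K ↔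
    (a < n ∧ b < m) ∧ n.Coprime a ∧ m.Coprime b ∧ (K : ℤ) ∣ a * m - b * n := by
  simp [closePairs]

theorem card_closePairs_mul_le {n m K M : ℕ} (hn : n ≠ 0) (hm : m ≠ 0) (hK : K ≠ 0) (hM : M ≠ 0)
    (hKn : K.Coprime n) (hKm : K.Coprime m) (h : M * K * n.gcd m ≤ n * m) :
    (closePairs n m K).card * K * (n.gcd M * m.gcd M) ≤
      3 * (n.gcd M).totient * (m.gcd M).totient * (n * m) := by
  classical
  set P := n.gcd M with hP
  set R := m.gcd M with hR
  set d := n.gcd m with hd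
  have hd0 : 0 < d := Nat.gcd_pos_of_pos_left _ (Nat.pos_of_ne_zero hn)
  have hP0 : 0 < P := Nat.gcd_pos_of_pos_left _ (Nat.pos_of_ne_zero hn)
  have hR0 : 0 < R := Nat.gcd_pos_of_pos_left _ (Nat.pos_of_ne_zero hm)
  obtain ⟨n', hn'⟩ : d ∣ n := Nat.gcd_dvd_left n m
  obtain ⟨m', hm'⟩ : d ∣ m := Nat.gcd_dvd_right n m
  have hcop : n'.Coprime m' := by
    have h1 := Nat.coprime_div_gcd_div_gcd (m := n) (n := m) hd0
    rw [← hd] at h1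
    rwa [hn', hm', Nat.mul_div_cancel_left _ hd0, Nat.mul_div_cancel_left _ hd0] at h1
  have hn'0 : 0 < n' := Nat.pos_of_ne_zero fun h0 => hn (by rw [hn', h0, mul_zero])
  have hm'0 : 0 < m' := Nat.pos_of_ne_zero fun h0 => hm (by rw [hm', h0, mul_zero])
  set D := P.gcd R with hD
  set L := P.lcm R with hL
  have hLD : D * L = P * R := Nat.gcd_mul_lcm P R
  have hL0 : 0 < L := Nat.lcm_pos hP0 hR0
  have hLM : L ≤ M := Nat.le_of_dvd (Nat.pos_of_ne_zero hM)
    (Nat.lcm_dvd (Nat.gcd_dvd_right _ _) (Nat.gcd_dvd_right _ _))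
  have hD0 : 0 < D := Nat.gcd_pos_of_pos_left _ hP0
  obtain ⟨t₂, ht₂⟩ : D ∣ d := Nat.dvd_gcd ((Nat.gcd_dvd_left _ _).trans (Nat.gcd_dvd_left _ _))
    ((Nat.gcd_dvd_right _ _).trans (Nat.gcd_dvd_left _ _))
  have hKL : L.Coprime K := by
    refine Nat.Coprime.coprime_dvd_left (Nat.lcm_dvd_mul P R) (Nat.Coprime.mul_left ?_ ?_)
    · exact (hKn.coprime_dvd_right (Nat.gcd_dvd_left _ _)).symm
    · exact (hKm.coprime_dvd_right (Nat.gcd_dvd_left _ _)).symm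
  set B := d * n' * m' with hB
  have hBd : B * d = n * m := by
    have h0 : n * m = (d * n') * (d * m') := by rw [← hn', ← hm']
    rw [hB, h0]; ring
  have hqB : L * K ≤ B := by
    refine Nat.le_of_mul_le_mul_right (c := d) ?_ hd0
    rw [hBd]
    exact le_trans (by gcongr) h
  set q := L * K with hq
  have hq0 : 0 < q := Nat.mul_pos hL0 (Nat.pos_of_ne_zero hK)
  set t₁ := 2 * B / q + 1 with ht₁
  have ht₁B : q * t₁ ≤ 3 * B := by
    have := Nat.mul_div_le (2 * B) q
    rw [ht₁, mul_add, mul_one]; omega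
  have ht₁lt : 2 * B < q * t₁ := Nat.lt_mul_div_succ _ hq0
  have hPcop : ∀ x y : ℤ, (P : ℤ) ∣ x → (R : ℤ) ∣ y → (L : ℤ) ∣ x * m' - y * n' := by
    have aux : ∀ (N N' M₁ : ℕ) (y : ℤ), (N.gcd M : ℕ) ∣ d * N' → d ∣ M₁ → ((M₁.gcd M : ℕ) : ℤ) ∣ y →
        ((N.gcd M : ℕ) : ℤ) ∣ y * N' := by
      intro N N' M₁ y h1 h2 h3
      have h4 : N.gcd M ∣ (N.gcd M).gcd d * (N.gcd M).gcd N' :=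
        (Nat.dvd_gcd dvd_rfl h1).trans (Nat.gcd_mul_right_dvd_mul_gcd _ _ _)
      have h5 : (N.gcd M).gcd d ∣ M₁.gcd M := Nat.dvd_gcd ((Nat.gcd_dvd_right _ _).trans h2)
        ((Nat.gcd_dvd_left _ _).trans (Nat.gcd_dvd_right _ _))
      have h6 : (((N.gcd M).gcd d * (N.gcd M).gcd N' : ℕ) : ℤ) ∣ y * N' := by
        push_cast
        exact mul_dvd_mul ((Int.natCast_dvd_natCast.2 h5).trans h3)
          (Int.natCast_dvd_natCast.2 (Nat.gcd_dvd_right _ _))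
      exact (Int.natCast_dvd_natCast.2 h4).trans h6
    intro x y hx hy
    rw [hL, Int.natCast_dvd]
    refine Nat.lcm_dvd ?_ ?_ <;> rw [← Int.natCast_dvd]
    · refine dvd_sub (hx.mul_right _) (aux n n' m y ?_ ⟨m', hm'⟩ hy)
      rw [← hn']; exact Nat.gcd_dvd_left _ _
    · refine dvd_sub (aux m m' n x ?_ ⟨n', hn'⟩ hx) (hy.mul_right _)
      rw [← hm']; exact Nat.gcd_dvd_left _ _
  have hdK : IsCoprime (K : ℤ) (d : ℤ) :=
    Nat.isCoprime_iff_coprime.2 (hKn.coprime_dvd_right (Nat.gcd_dvd_left _ _))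
  have hKdvd : ∀ a b : ℕ, (a, b) ∈ closePairs n m K → (K : ℤ) ∣ (a : ℤ) * m' - b * n' := by
    intro a b hab
    have h1 := (mem_closePairs.1 hab).2.2.2
    rw [hn', hm'] at h1
    refine hdK.dvd_of_dvd_mul_left (?_ : (K : ℤ) ∣ d * _)
    convert h1 using 1
    push_cast; ring
  set C := (Finset.range P).filter P.Coprime ×ˢ (Finset.range R).filter R.Coprime with hC
  have hCcard : C.card = P.totient * R.totient := by
    rw [hC, Finset.card_product]; rfl
  have hclass : ∀ c ∈ C, ((closePairs n m K).filter
      (fun x => (x.1 % P, x.2 % R) = c)).card ≤ t₂ * t₁ := by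
    rintro ⟨α, β⟩ -
    set F := (closePairs n m K).filter (fun x => (x.1 % P, x.2 % R) = (α, β)) with hF
    have hFmem : ∀ x ∈ F, x ∈ closePairs n m K ∧ x.1 % P = α ∧ x.2 % R = β := by
      intro x hx
      rw [hF, Finset.mem_filter, Prod.mk.injEq] at hx
      exact hx
    have hFdvd : ∀ x ∈ F, ∀ y ∈ F, (P : ℤ) ∣ (x.1 : ℤ) - y.1 ∧ (R : ℤ) ∣ (x.2 : ℤ) - y.2 := by
      intro x hx y hy
      have h1 := hFmem x hx
      have h2 := hFmem y hy
      constructor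
      · exact Nat.modEq_iff_dvd.1 (h2.2.1.trans h1.2.1.symm)
      · exact Nat.modEq_iff_dvd.1 (h2.2.2.trans h1.2.2.symm)
    set e : ℕ × ℕ → ℤ := fun x => (x.1 : ℤ) * m' - x.2 * n' with he
    have himage : (F.image e).card ≤ t₁ := by
      refine card_le_of_congruent (lo := -(B : ℤ)) hq0 ?_ ?_
      · intro z hz
        obtain ⟨⟨a, b⟩, hx, rfl⟩ := Finset.mem_image.1 hz
        have h1 := (mem_closePairs.1 (hFmem _ hx).1).1
        have ha : a * m' ≤ B := by
          rw [hB, ← hn']; exact Nat.mul_le_mul_right _ h1.1.le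
        have hb : b * n' ≤ B := by
          rw [hB, mul_right_comm, ← hm']; exact Nat.mul_le_mul_right _ h1.2.le
        have hlt : (2 * B : ℤ) < q * t₁ := by exact_mod_cast ht₁lt
        simp only [he]
        have ha' : (a : ℤ) * m' ≤ B := by exact_mod_cast ha
        have hb' : (b : ℤ) * n' ≤ B := by exact_mod_cast hb
        have ha0 : (0 : ℤ) ≤ (a : ℤ) * m' := by positivity
        have hb0 : (0 : ℤ) ≤ (b : ℤ) * n' := by positivity
        constructor <;> linarith
      · intro z hz w hw
        obtain ⟨x, hx, rfl⟩ := Finset.mem_image.1 hz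
        obtain ⟨y, hy, rfl⟩ := Finset.mem_image.1 hw
        have h1 : (L : ℤ) ∣ e x - e y := by
          have := hPcop _ _ (hFdvd x hx y hy).1 (hFdvd x hx y hy).2
          simp only [he]
          convert this using 1
          ring
        have h2 : (K : ℤ) ∣ e x - e y :=
          dvd_sub (hKdvd _ _ (hFmem x hx).1) (hKdvd _ _ (hFmem y hy).1)
        rw [hq]
        push_cast
        exact (Nat.isCoprime_iff_coprime.2 hKL).mul_dvd h1 h2
    refine (Finset.card_le_mul_card_image (f := e) F t₂ ?_).trans
      (Nat.mul_le_mul_left _ himage)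
    intro z _
    set G := F.filter (fun x => e x = z) with hG
    have hGmem : ∀ x ∈ G, x ∈ F ∧ e x = z := fun x hx => Finset.mem_filter.1 hx
    have hinj : Set.InjOn (fun x : ℕ × ℕ => (x.1 : ℤ)) (G : Set (ℕ × ℕ)) := by
      intro x hx y hy hxy
      have h1 := (hGmem x hx).2.trans (hGmem y hy).2.symm
      simp only [he] at h1 hxy
      have h2 : (x.2 : ℤ) = y.2 := by
        have : (n' : ℤ) ≠ 0 := by exact_mod_cast hn'0.ne'
        refine mul_right_cancel₀ this ?_
        rw [hxy] at h1; linarith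
      exact Prod.ext (by exact_mod_cast hxy) (by exact_mod_cast h2)
    rw [← Finset.card_image_of_injOn hinj]
    refine card_le_of_congruent (lo := 0) (q := D * n') (Nat.mul_pos hD0 hn'0) ?_ ?_
    · intro w hw
      obtain ⟨⟨a, b⟩, hx, rfl⟩ := Finset.mem_image.1 hw
      have h1 := (mem_closePairs.1 (hFmem _ (hGmem _ hx).1).1).1.1
      refine ⟨by positivity, ?_⟩
      have h2 : a < D * n' * t₂ := by
        calc a < n := h1
          _ = D * n' * t₂ := by rw [hn', ht₂]; ring
      simp only [zero_add]
      exact_mod_cast h2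
    · intro w hw v hv
      obtain ⟨x, hx, rfl⟩ := Finset.mem_image.1 hw
      obtain ⟨y, hy, rfl⟩ := Finset.mem_image.1 hv
      have h1 := (hGmem x hx).2.trans (hGmem y hy).2.symm
      simp only [he] at h1
      have h2 : ((x.1 : ℤ) - y.1) * m' = (x.2 - y.2) * n' := by linarith
      have hc : IsCoprime (n' : ℤ) (m' : ℤ) := Nat.isCoprime_iff_coprime.2 hcop
      obtain ⟨s, hs⟩ : (n' : ℤ) ∣ (x.1 : ℤ) - y.1 :=
        hc.dvd_of_dvd_mul_right ⟨_, h2.trans (mul_comm _ _)⟩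
      have hs2 : (x.2 : ℤ) - y.2 = m' * s := by
        have : (n' : ℤ) ≠ 0 := by exact_mod_cast hn'0.ne'
        refine mul_right_cancel₀ this ?_
        rw [← h2, hs]; ring
      have hdv := hFdvd x (hGmem x hx).1 y (hGmem y hy).1
      have hDn : (D : ℤ) ∣ n' * s := by
        rw [← hs]; exact (Int.natCast_dvd_natCast.2 (Nat.gcd_dvd_left P R)).trans hdv.1
      have hDm : (D : ℤ) ∣ m' * s := by
        rw [← hs2]; exact (Int.natCast_dvd_natCast.2 (Nat.gcd_dvd_right P R)).trans hdv.2
      have hDs : (D : ℤ) ∣ s := by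
        obtain ⟨u, v, huv⟩ := hc
        have : s = u * (n' * s) + v * (m' * s) := by linear_combination (-s) * huv
        rw [this]
        exact dvd_add (hDn.mul_left _) (hDm.mul_left _)
      simp only [hs]
      push_cast
      rw [mul_comm (D : ℤ)]
      exact mul_dvd_mul_left _ hDs
  have hmaps : ∀ x ∈ closePairs n m K, (x.1 % P, x.2 % R) ∈ C := by
    rintro ⟨a, b⟩ hx
    have h1 := mem_closePairs.1 hx
    rw [hC, Finset.mem_product, Finset.mem_filter, Finset.mem_filter, Finset.mem_range,
      Finset.mem_range]
    refine ⟨⟨Nat.mod_lt _ hP0, ?_⟩, Nat.mod_lt _ hR0, ?_⟩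
    · have := h1.2.1.coprime_dvd_left (Nat.gcd_dvd_left n M)
      show Nat.gcd P (a % P) = 1
      rw [Nat.gcd_comm, ← Nat.gcd_rec]
      exact this
    · have := h1.2.2.1.coprime_dvd_left (Nat.gcd_dvd_left m M)
      show Nat.gcd R (b % R) = 1
      rw [Nat.gcd_comm, ← Nat.gcd_rec]
      exact this
  have htotal := Finset.card_le_mul_card_image_of_maps_to hmaps (t₂ * t₁) hclass
  rw [hCcard] at htotal
  calc (closePairs n m K).card * K * (P * R)
      ≤ t₂ * t₁ * (P.totient * R.totient) * K * (P * R) := by gcongr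
    _ = P.totient * R.totient * (D * t₂) * (q * t₁) := by rw [← hLD, hq]; ring
    _ ≤ P.totient * R.totient * d * (3 * B) := by rw [← ht₂]; gcongr
    _ = 3 * P.totient * R.totient * (n * m) := by rw [← hBd]; ring

theorem closePairs_eq_empty {n m K : ℕ} (hne : n ≠ m) (hKn : K.Coprime n)
    (h : n * m ≤ K * n.gcd m) : closePairs n m K = ∅ := by
  refine Finset.eq_empty_of_forall_notMem ?_
  rintro ⟨a, b⟩ hab
  obtain ⟨⟨ha, hb⟩, hna, hmb, hdvd⟩ := mem_closePairs.1 hab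
  have hd : ((n.gcd m : ℕ) : ℤ) ∣ a * m - b * n :=
    dvd_sub ((Int.natCast_dvd_natCast.2 (Nat.gcd_dvd_right n m)).mul_left _)
      ((Int.natCast_dvd_natCast.2 (Nat.gcd_dvd_left n m)).mul_left _)
  have hcop : IsCoprime (K : ℤ) ((n.gcd m : ℕ) : ℤ) :=
    Nat.isCoprime_iff_coprime.2 (hKn.coprime_dvd_right (Nat.gcd_dvd_left _ _))
  have hKd : ((K * n.gcd m : ℕ) : ℤ) ∣ a * m - b * n := by
    push_cast
    exact hcop.mul_dvd hdvd hd
  have h0 : (a * m - b * n : ℤ) = 0 := by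
    refine Int.eq_zero_of_abs_lt_dvd hKd ?_
    have h1 : (a * m : ℤ) < n * m := by exact_mod_cast Nat.mul_lt_mul_of_pos_right ha (by omega)
    have h2 : (b * n : ℤ) < n * m := by
      rw [mul_comm (n : ℤ)]
      exact_mod_cast Nat.mul_lt_mul_of_pos_right hb (by omega)
    have h3 : (n * m : ℤ) ≤ ((K * n.gcd m : ℕ) : ℤ) := by exact_mod_cast h
    have h4 : (0 : ℤ) ≤ a * m := by positivity
    have h5 : (0 : ℤ) ≤ b * n := by positivity
    rw [abs_lt]
    constructor <;> linarith
  have h1 : a * m = b * n := by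
    have := sub_eq_zero.1 h0
    exact_mod_cast this
  have h2 : n ∣ m := hna.dvd_of_dvd_mul_left (h1 ▸ Dvd.intro_left b rfl)
  have h3 : m ∣ n := hmb.dvd_of_dvd_mul_left (h1 ▸ Dvd.intro_left a rfl)
  exact hne (Nat.dvd_antisymm h2 h3)

theorem card_closePairs_mul_le_trivial {n m K : ℕ} (hn : n ≠ 0) (hm : m ≠ 0) (hK : K ≠ 0)
    (hKn : K.Coprime n) (hKm : K.Coprime m) (h : K * n.gcd m ≤ n * m) :
    (closePairs n m K).card * K ≤ 3 * (n * m) := by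
  simpa using card_closePairs_mul_le hn hm hK one_ne_zero hKn hKm (by simpa using h)

theorem card_closePairs_mul_le_totient {n m K T : ℕ} (hn : n ≠ 0) (hm : m ≠ 0) (hK : K ≠ 0)
    (hKn : K.Coprime n) (hKm : K.Coprime m) (hnT : cutoff n ≤ T) (hmT : cutoff m ≤ T)
    (h : 4 ^ T * K * n.gcd m ≤ n * m) :
    ((closePairs n m K).card * K : ℝ) ≤ 3 * Real.exp 4 * (n.totient * m.totient) := by
  set M := primorial T with hM
  have hM0 : M ≠ 0 := (primorial_pos T).ne'
  have hle : M * K * n.gcd m ≤ n * m :=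
    le_trans (by gcongr; exact primorial_le_four_pow T) h
  have key := card_closePairs_mul_le hn hm hK hM0 hKn hKm hle
  have aux : ∀ N : ℕ, cutoff N ≤ T →
      ((N.gcd M).totient : ℝ) * N ≤ N.totient * (N.gcd M : ℕ) * Real.exp 2 := by
    intro N hN
    refine (totient_gcd_mul_le (T := T) hM0 fun q hq _ hqT => ?_).trans ?_
    · exact Finset.dvd_prod_of_mem _ (by simp [hq, Nat.lt_succ_of_le hqT])
    · gcongr
      linarith [primeTail_le_one hN]
  have hP : (0 : ℝ) < (n.gcd M : ℕ) := by
    exact_mod_cast Nat.gcd_pos_of_pos_left _ (Nat.pos_of_ne_zero hn)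
  have hR : (0 : ℝ) < (m.gcd M : ℕ) := by
    exact_mod_cast Nat.gcd_pos_of_pos_left _ (Nat.pos_of_ne_zero hm)
  have key' : ((closePairs n m K).card * K : ℝ) * ((n.gcd M : ℕ) * (m.gcd M : ℕ)) ≤
      3 * ((((n.gcd M).totient : ℝ) * n) * (((m.gcd M).totient : ℝ) * m)) := by
    calc _ ≤ (3 * (n.gcd M).totient * (m.gcd M).totient * (n * m) : ℝ) := by exact_mod_cast key
      _ = _ := by ring
  refine le_of_mul_le_mul_right (key'.trans ?_) (mul_pos hP hR)
  calc 3 * ((((n.gcd M).totient : ℝ) * n) * (((m.gcd M).totient : ℝ) * m))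
      ≤ 3 * ((n.totient * (n.gcd M : ℕ) * Real.exp 2) *
          (m.totient * (m.gcd M : ℕ) * Real.exp 2)) := by
        refine mul_le_mul_of_nonneg_left ?_ (by norm_num)
        exact mul_le_mul (aux n hnT) (aux m hmT) (by positivity) (by positivity)
    _ = _ := by
        rw [show (4 : ℝ) = 2 + 2 by norm_num, Real.exp_add]; ring

theorem sum_half_pow_le_two (X : Finset ℕ) : ∑ T ∈ X, (1 / 2 : ℝ) ^ T ≤ 2 :=
  (summable_geometric_two.sum_le_tsum X fun _ _ => by positivity).trans_eq tsum_geometric_two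

theorem sparseConst_pos : 0 < sparseConst := by
  have : 0 < momentConst := Real.exp_pos _
  unfold sparseConst
  positivity

theorem sum_gcd_cutoff_le {m : ℕ} (hm : m ≠ 0) {A : Finset ℕ} (hA0 : ∀ n ∈ A, n ≠ 0)
    (hA : ∀ n ∈ A, cutoff m ≤ cutoff n) {V Y : ℕ → ℕ → ℝ} {z : ℝ} (hV : ∀ T d, 0 ≤ V T d)
    (hY0 : ∀ T d, 0 ≤ Y T d)
    (hY : ∀ n ∈ A, ((n / n.gcd m : ℕ) : ℝ) ≤ Y (cutoff n) (n.gcd m))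
    (hVY : ∀ T, ∀ d ∈ m.divisors, V T d * Y T d ≤ z * m * 4 ^ T * (d : ℝ)⁻¹) (hz : 0 ≤ z) :
    ∑ n ∈ A, V (cutoff n) (n.gcd m) ≤ z * m.totient * sparseConst * 2 := by
  classical
  rw [← Finset.sum_fiberwise_of_maps_to (fun n hn => Finset.mem_image_of_mem cutoff hn)]
  have hfib : ∀ T ∈ A.image cutoff, ∑ n ∈ A with cutoff n = T, V (cutoff n) (n.gcd m) ≤
      z * m.totient * sparseConst * (1 / 2) ^ T := by
    intro T hT
    rw [Finset.sum_congr rfl (g := fun n => V T (n.gcd m))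
      fun n hn => by rw [(Finset.mem_filter.1 hn).2]]
    obtain ⟨n₀, hn₀, rfl⟩ := Finset.mem_image.1 hT
    refine sum_gcd_le_totient hm (hA n₀ hn₀) (fun n hn => hA0 n (Finset.mem_filter.1 hn).1)
      (fun n hn => (Finset.mem_filter.1 hn).2) (hV _) (hY0 _) (fun n hn => ?_) (hVY _) hz
    have := hY n (Finset.mem_filter.1 hn).1
    rwa [(Finset.mem_filter.1 hn).2] at this
  refine (Finset.sum_le_sum hfib).trans ?_
  rw [← Finset.mul_sum]
  have := sparseConst_pos
  exact mul_le_mul_of_nonneg_left (sum_half_pow_le_two _) (by positivity)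

/-- The pairs for which neither the equidistribution bound nor emptiness is available. -/
def sparseRel (K : ℕ → ℕ) (n m : ℕ) : Prop :=
  K n * n.gcd m < n * m ∧ n * m < 4 ^ max (cutoff n) (cutoff m) * K n * n.gcd m

theorem sum_sparse_left_le {F : Finset ℕ} {K : ℕ → ℕ} {C : ℝ} (hC0 : 0 ≤ C)
    (hF0 : ∀ n ∈ F, n ≠ 0) (hK : ∀ n, 0 < K n) (hC : ∀ n ∈ F, (n : ℝ) ^ 2 ≤ C * K n) {m : ℕ}
    (hm : m ≠ 0) {A : Finset ℕ} (hAF : A ⊆ F)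
    (hA : ∀ n ∈ A, sparseRel K n m ∧ cutoff m ≤ cutoff n) :
    ∑ n ∈ A, 3 * (n * (K n : ℝ)⁻¹) * (m * (K m : ℝ)⁻¹) ≤
      6 * C * sparseConst * (m.totient * (K m : ℝ)⁻¹) := by
  have hm0 : (0 : ℝ) < m := by exact_mod_cast Nat.pos_of_ne_zero hm
  have hterm : ∀ n ∈ A, 3 * (n * (K n : ℝ)⁻¹) * (m * (K m : ℝ)⁻¹) ≤
      3 * (K m : ℝ)⁻¹ * 4 ^ cutoff n * (n.gcd m : ℕ) := by
    intro n hn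
    have h1 := (hA n hn).1.2
    rw [max_eq_left (hA n hn).2] at h1
    have h2 : (n * m : ℝ) ≤ 4 ^ cutoff n * K n * (n.gcd m : ℕ) := by exact_mod_cast h1.le
    have hKn : (0 : ℝ) < K n := by exact_mod_cast hK n
    have h3 : (n * m : ℝ) * (K n : ℝ)⁻¹ ≤ 4 ^ cutoff n * (n.gcd m : ℕ) := by
      rw [← div_eq_mul_inv, div_le_iff₀ hKn]
      linarith
    calc 3 * (n * (K n : ℝ)⁻¹) * (m * (K m : ℝ)⁻¹)
        = 3 * (K m : ℝ)⁻¹ * ((n * m : ℝ) * (K n : ℝ)⁻¹) := by ring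
      _ ≤ 3 * (K m : ℝ)⁻¹ * (4 ^ cutoff n * (n.gcd m : ℕ)) := by gcongr
      _ = _ := by ring
  refine (Finset.sum_le_sum hterm).trans ?_
  refine (sum_gcd_cutoff_le hm (fun n hn => hF0 n (hAF hn)) (fun n hn => (hA n hn).2)
    (V := fun T d => 3 * (K m : ℝ)⁻¹ * 4 ^ T * d) (Y := fun _ d => C * m / d ^ 2)
    (z := 3 * C * (K m : ℝ)⁻¹) (fun _ _ => by positivity) (fun _ _ => by positivity) ?_ ?_
    (by positivity)).trans_eq (by ring)
  · intro n hn
    have hn0 : (0 : ℝ) < n := by exact_mod_cast Nat.pos_of_ne_zero (hF0 n (hAF hn))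
    have hd : (0 : ℝ) < (n.gcd m : ℕ) := by
      exact_mod_cast Nat.gcd_pos_of_pos_right _ (Nat.pos_of_ne_zero hm)
    have h1 : (K n * (n.gcd m : ℕ) : ℝ) ≤ n * m := by exact_mod_cast (hA n hn).1.1.le
    rw [Nat.cast_div (Nat.gcd_dvd_left n m) hd.ne', div_le_div_iff₀ hd (by positivity)]
    have h2 : (n : ℝ) * (n.gcd m : ℕ) ≤ C * m := by
      refine le_of_mul_le_mul_left ?_ hn0
      calc (n : ℝ) * (n * (n.gcd m : ℕ)) = n ^ 2 * (n.gcd m : ℕ) := by ring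
        _ ≤ C * K n * (n.gcd m : ℕ) := by gcongr; exact hC n (hAF hn)
        _ = C * (K n * (n.gcd m : ℕ)) := by ring
        _ ≤ C * (n * m) := by gcongr
        _ = n * (C * m) := by ring
    calc (n : ℝ) * (n.gcd m : ℕ) ^ 2 = n * (n.gcd m : ℕ) * (n.gcd m : ℕ) := by ring
      _ ≤ _ := by gcongr
  · intro T d hd
    have hd0 : (d : ℝ) ≠ 0 := by exact_mod_cast (Nat.pos_of_mem_divisors hd).ne'
    refine le_of_eq ?_
    field_simp

theorem sum_sparse_right_le {F : Finset ℕ} {K : ℕ → ℕ} {C : ℝ} (hC0 : 0 ≤ C)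
    (hF0 : ∀ n ∈ F, n ≠ 0) (hK : ∀ n, 0 < K n) (hC : ∀ n ∈ F, (n : ℝ) ^ 2 ≤ C * K n) {n : ℕ}
    (hn : n ≠ 0) {A : Finset ℕ} (hAF : A ⊆ F)
    (hA : ∀ m ∈ A, sparseRel K n m ∧ cutoff n ≤ cutoff m) :
    ∑ m ∈ A, 3 * (n * (K n : ℝ)⁻¹) * (m * (K m : ℝ)⁻¹) ≤
      6 * C * sparseConst * (n.totient * (K n : ℝ)⁻¹) := by
  have hn0 : (0 : ℝ) < n := by exact_mod_cast Nat.pos_of_ne_zero hn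
  have hKn : (0 : ℝ) < K n := by exact_mod_cast hK n
  have hd : ∀ m : ℕ, (0 : ℝ) < (m.gcd n : ℕ) := fun m => by
    exact_mod_cast Nat.gcd_pos_of_pos_right _ (Nat.pos_of_ne_zero hn)
  have hterm : ∀ m ∈ A, 3 * (n * (K n : ℝ)⁻¹) * (m * (K m : ℝ)⁻¹) ≤
      3 * C * (n * (K n : ℝ)⁻¹) ^ 2 / (m.gcd n : ℕ) := by
    intro m hm
    have hKm : (0 : ℝ) < K m := by exact_mod_cast hK m
    have hm0 : (0 : ℝ) < m := by exact_mod_cast Nat.pos_of_ne_zero (hF0 m (hAF hm))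
    have h1 := (hA m hm).1.1
    rw [Nat.gcd_comm] at h1
    have h2 : (K n * (m.gcd n : ℕ) : ℝ) ≤ n * m := by exact_mod_cast h1.le
    have h3 : (m * (K m : ℝ)⁻¹) ≤ C * (n * (K n : ℝ)⁻¹) / (m.gcd n : ℕ) := by
      rw [le_div_iff₀ (hd m)]
      refine le_of_mul_le_mul_left ?_ (mul_pos hm0 hKn)
      calc (m * K n : ℝ) * (m * (K m : ℝ)⁻¹ * (m.gcd n : ℕ))
          = m ^ 2 * (K m : ℝ)⁻¹ * (K n * (m.gcd n : ℕ)) := by ring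
        _ ≤ C * K m * (K m : ℝ)⁻¹ * (n * m) := by
            gcongr
            exact hC m (hAF hm)
        _ = m * K n * (C * (n * (K n : ℝ)⁻¹)) := by field_simp
    calc 3 * (n * (K n : ℝ)⁻¹) * (m * (K m : ℝ)⁻¹)
        ≤ 3 * (n * (K n : ℝ)⁻¹) * (C * (n * (K n : ℝ)⁻¹) / (m.gcd n : ℕ)) := by gcongr
      _ = _ := by ring
  refine (Finset.sum_le_sum hterm).trans ?_
  refine (sum_gcd_cutoff_le hn (fun m hm => hF0 m (hAF hm)) (fun m hm => (hA m hm).2)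
    (V := fun _ d => 3 * C * (n * (K n : ℝ)⁻¹) ^ 2 / d)
    (Y := fun T _ => 4 ^ T / (n * (K n : ℝ)⁻¹))
    (z := 3 * C * (K n : ℝ)⁻¹) (fun _ _ => by positivity) (fun _ _ => by positivity) ?_ ?_
    (by positivity)).trans_eq (by ring)
  · intro m hm
    have h1 := (hA m hm).1.2
    rw [max_eq_right (hA m hm).2, Nat.gcd_comm] at h1
    have h2 : (n * m : ℝ) ≤ 4 ^ cutoff m * K n * (m.gcd n : ℕ) := by exact_mod_cast h1.le
    rw [Nat.cast_div (Nat.gcd_dvd_left m n) (hd m).ne', div_le_div_iff₀ (hd m) (by positivity)]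
    calc (m : ℝ) * (n * (K n : ℝ)⁻¹) = (n * m) * (K n : ℝ)⁻¹ := by ring
      _ ≤ 4 ^ cutoff m * K n * (m.gcd n : ℕ) * (K n : ℝ)⁻¹ := by gcongr
      _ = _ := by field_simp
  · intro T d hd
    have hd0 : (d : ℝ) ≠ 0 := by exact_mod_cast (Nat.pos_of_mem_divisors hd).ne'
    refine le_of_eq ?_
    field_simp

/-- The constant in the linear term of the overlap bound. -/
def overlapConst (C : ℝ) : ℝ := 12 * C * sparseConst

theorem sum_closePairs_le {F : Finset ℕ} {K : ℕ → ℕ} {C : ℝ} (hC0 : 0 ≤ C)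
    (hF0 : ∀ n ∈ F, n ≠ 0) (hK : ∀ n, 0 < K n) (hC : ∀ n ∈ F, (n : ℝ) ^ 2 ≤ C * K n)
    (hcop : ∀ n ∈ F, ∀ m ∈ F, (K n).Coprime m) :
    ∑ n ∈ F, ∑ m ∈ F, (if n = m then 0 else ((closePairs n m (K n)).card : ℝ) * (K m : ℝ)⁻¹) ≤
      3 * Real.exp 4 * (∑ n ∈ F, n.totient * (K n : ℝ)⁻¹) ^ 2 +
        overlapConst C * ∑ n ∈ F, n.totient * (K n : ℝ)⁻¹ := by
  classical
  set L := ∑ n ∈ F, n.totient * (K n : ℝ)⁻¹ with hL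
  set w : ℕ → ℕ → ℝ := fun n m => 3 * (n * (K n : ℝ)⁻¹) * (m * (K m : ℝ)⁻¹) with hw
  have hw0 : ∀ n m, 0 ≤ w n m := fun n m => by simp only [hw]; positivity
  have hterm : ∀ n ∈ F, ∀ m ∈ F,
      (if n = m then 0 else ((closePairs n m (K n)).card : ℝ) * (K m : ℝ)⁻¹) ≤
      3 * Real.exp 4 * ((n.totient * (K n : ℝ)⁻¹) * (m.totient * (K m : ℝ)⁻¹)) +
      ((if sparseRel K n m ∧ cutoff m ≤ cutoff n then w n m else 0) +
      (if sparseRel K n m ∧ cutoff n ≤ cutoff m then w n m else 0)) := by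
    intro n hn m hm
    have hKn : (0 : ℝ) < K n := by exact_mod_cast hK n
    have hA : (0 : ℝ) ≤ if sparseRel K n m ∧ cutoff m ≤ cutoff n then w n m else 0 := by
      split_ifs; exacts [hw0 _ _, le_rfl]
    have hB : (0 : ℝ) ≤ if sparseRel K n m ∧ cutoff n ≤ cutoff m then w n m else 0 := by
      split_ifs; exacts [hw0 _ _, le_rfl]
    have hG : 0 ≤ 3 * Real.exp 4 * ((n.totient * (K n : ℝ)⁻¹) * (m.totient * (K m : ℝ)⁻¹)) := by
      positivity
    have hcard : ((closePairs n m (K n)).card : ℝ) * (K m : ℝ)⁻¹ =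
        ((closePairs n m (K n)).card * K n : ℝ) * ((K n : ℝ)⁻¹ * (K m : ℝ)⁻¹) := by
      field_simp
    by_cases hne : n = m
    · rw [if_pos hne]
      positivity
    · rw [if_neg hne]
      by_cases h1 : n * m ≤ K n * n.gcd m
      · rw [closePairs_eq_empty hne (hcop n hn n hn) h1]
        simp only [Finset.card_empty, Nat.cast_zero, zero_mul]
        positivity
      · by_cases h2 : 4 ^ max (cutoff n) (cutoff m) * K n * n.gcd m ≤ n * m
        · have h3 := card_closePairs_mul_le_totient (hF0 n hn) (hF0 m hm) (hK n).ne'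
            (hcop n hn n hn) (hcop n hn m hm) (le_max_left _ _) (le_max_right _ _) h2
          have h4 : ((closePairs n m (K n)).card : ℝ) * (K m : ℝ)⁻¹ ≤
              3 * Real.exp 4 * ((n.totient * (K n : ℝ)⁻¹) * (m.totient * (K m : ℝ)⁻¹)) := by
            rw [hcard]
            calc _ ≤ 3 * Real.exp 4 * (n.totient * m.totient) * ((K n : ℝ)⁻¹ * (K m : ℝ)⁻¹) := by
                  gcongr
              _ = _ := by ring
          linarith
        · have hrel : sparseRel K n m := ⟨not_le.1 h1, not_le.1 h2⟩
          have h3 : ((closePairs n m (K n)).card * K n : ℝ) ≤ 3 * (n * m) := by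
            exact_mod_cast card_closePairs_mul_le_trivial (hF0 n hn) (hF0 m hm) (hK n).ne'
              (hcop n hn n hn) (hcop n hn m hm) (not_le.1 h1).le
          have h4 : ((closePairs n m (K n)).card : ℝ) * (K m : ℝ)⁻¹ ≤ w n m := by
            rw [hcard]
            calc _ ≤ 3 * (n * m) * ((K n : ℝ)⁻¹ * (K m : ℝ)⁻¹) := by gcongr
              _ = _ := by simp only [hw]; ring
          rcases le_total (cutoff m) (cutoff n) with h5 | h5
          · rw [if_pos ⟨hrel, h5⟩] at hA ⊢
            linarith
          · rw [if_pos (c := sparseRel K n m ∧ cutoff n ≤ cutoff m) ⟨hrel, h5⟩] at hB ⊢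
            linarith
  refine (Finset.sum_le_sum fun n hn => Finset.sum_le_sum fun m hm => hterm n hn m hm).trans ?_
  simp only [Finset.sum_add_distrib]
  have hgood : ∑ n ∈ F, ∑ m ∈ F,
      3 * Real.exp 4 * ((n.totient * (K n : ℝ)⁻¹) * (m.totient * (K m : ℝ)⁻¹)) =
      3 * Real.exp 4 * L ^ 2 := by
    rw [pow_two, hL, Finset.sum_mul_sum, Finset.mul_sum]
    exact Finset.sum_congr rfl fun n _ => by rw [Finset.mul_sum]
  have hleft : ∑ n ∈ F, ∑ m ∈ F,
      (if sparseRel K n m ∧ cutoff m ≤ cutoff n then w n m else 0) ≤ 6 * C * sparseConst * L := by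
    rw [Finset.sum_comm, hL, Finset.mul_sum]
    refine Finset.sum_le_sum fun m hm => ?_
    rw [← Finset.sum_filter]
    exact sum_sparse_left_le hC0 hF0 hK hC (hF0 m hm) (Finset.filter_subset _ _)
      fun n hn => (Finset.mem_filter.1 hn).2
  have hright : ∑ n ∈ F, ∑ m ∈ F,
      (if sparseRel K n m ∧ cutoff n ≤ cutoff m then w n m else 0) ≤ 6 * C * sparseConst * L := by
    rw [hL, Finset.mul_sum]
    refine Finset.sum_le_sum fun n hn => ?_
    rw [← Finset.sum_filter]
    exact sum_sparse_right_le hC0 hF0 hK hC (hF0 n hn) (Finset.filter_subset _ _)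
      fun m hm => (Finset.mem_filter.1 hm).2
  rw [hgood, overlapConst]
  linarith

/-- The residue class of `c` modulo `p ^ k` in the `p`-adic integers. -/
def residueBall (p : ℕ) [Fact p.Prime] (k : ℕ) (c : ℤ_[p]) : Set ℤ_[p] :=
  {x | (p : ℤ_[p]) ^ k ∣ x - c}

theorem residueBall_eq_closedBall (p : ℕ) [Fact p.Prime] (k : ℕ) (c : ℤ_[p]) :
    residueBall p k c = Metric.closedBall c ((p : ℝ) ^ (-k : ℤ)) := by
  ext x
  rw [Metric.mem_closedBall, dist_eq_norm, PadicInt.norm_le_pow_iff_mem_span_pow,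
    Ideal.mem_span_singleton]
  rfl

theorem measurableSet_residueBall (p : ℕ) [Fact p.Prime] [MeasurableSpace ℤ_[p]]
    [BorelSpace ℤ_[p]] (k : ℕ) (c : ℤ_[p]) : MeasurableSet (residueBall p k c) := by
  rw [residueBall_eq_closedBall]
  exact Metric.isClosed_closedBall.measurableSet

theorem natCast_dvd_sub_natCast_iff (p : ℕ) [Fact p.Prime] {k a b : ℕ} (ha : a < p ^ k)
    (hb : b < p ^ k) : (p : ℤ_[p]) ^ k ∣ (a : ℤ_[p]) - b ↔ a = b := by
  constructor
  · intro h
    have h1 : (p : ℤ_[p]) ^ k ∣ ((a - b : ℤ) : ℤ_[p]) := by push_cast; exact h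
    rw [PadicInt.pow_p_dvd_int_iff] at h1
    have h2 : (a - b : ℤ) = 0 := by
      refine Int.eq_zero_of_abs_lt_dvd h1 ?_
      have h3 : (a : ℤ) < (p : ℤ) ^ k := by exact_mod_cast ha
      have h4 : (b : ℤ) < (p : ℤ) ^ k := by exact_mod_cast hb
      rw [abs_lt]
      constructor <;> linarith [Int.natCast_nonneg a, Int.natCast_nonneg b]
    have := sub_eq_zero.1 h2
    exact_mod_cast this
  · rintro rfl
    simp

theorem iUnion_residueBall (p : ℕ) [Fact p.Prime] (k : ℕ) :
    ⋃ b ∈ Finset.range (p ^ k), residueBall p k (b : ℤ_[p]) = Set.univ := by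
  refine Set.eq_univ_of_forall fun x => ?_
  simp only [Set.mem_iUnion, Finset.mem_range]
  exact ⟨x.appr k, PadicInt.appr_lt x k, Ideal.mem_span_singleton.1 (PadicInt.appr_spec k x)⟩

theorem pairwiseDisjoint_residueBall (p : ℕ) [Fact p.Prime] (k : ℕ) :
    (Finset.range (p ^ k) : Set ℕ).PairwiseDisjoint fun b => residueBall p k (b : ℤ_[p]) := by
  intro a ha b hb hab
  refine Set.disjoint_left.2 fun x hxa hxb => hab ?_
  rw [← natCast_dvd_sub_natCast_iff p (Finset.mem_range.1 ha) (Finset.mem_range.1 hb)]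
  have : (a : ℤ_[p]) - b = (x - b) - (x - a) := by ring
  rw [this]
  exact dvd_sub hxb hxa

theorem measure_residueBall (p : ℕ) [Fact p.Prime] [MeasurableSpace ℤ_[p]] [BorelSpace ℤ_[p]]
    (μ : Measure ℤ_[p]) [μ.IsAddHaarMeasure] [IsProbabilityMeasure μ] (k : ℕ) (c : ℤ_[p]) :
    μ.real (residueBall p k c) = ((p ^ k : ℕ) : ℝ)⁻¹ := by
  have htrans : ∀ c : ℤ_[p], μ.real (residueBall p k c) = μ.real (residueBall p k 0) := by
    intro c
    rw [measureReal_def, measureReal_def, ← measure_preimage_add_right μ c (residueBall p k c)]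
    congr 2
    ext x
    simp [residueBall]
  have h1 := measureReal_biUnion_finset (μ := μ) (pairwiseDisjoint_residueBall p k)
    fun b _ => measurableSet_residueBall p k _
  rw [iUnion_residueBall, probReal_univ, Finset.sum_congr rfl fun (b : ℕ) _ => htrans b,
    Finset.sum_const, Finset.card_range, nsmul_eq_mul] at h1
  rw [htrans]
  exact eq_inv_of_mul_eq_one_right h1.symm

/-- The points of `ℤ_p` that are congruent to `a / n` modulo `p ^ k`. -/
def fracBall (p : ℕ) [Fact p.Prime] (k n a : ℕ) : Set ℤ_[p] :=
  {x | (p : ℤ_[p]) ^ k ∣ n * x - a}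

theorem fracBall_eq_residueBall (p : ℕ) [Fact p.Prime] (k : ℕ) {n : ℕ} (hn : p.Coprime n)
    (a : ℕ) : ∃ c, fracBall p k n a = residueBall p k c := by
  have hu : IsUnit (n : ℤ_[p]) := by
    rw [PadicInt.isUnit_iff, PadicInt.norm_natCast_eq_one_iff]
    exact hn
  obtain ⟨u, hu⟩ := hu
  refine ⟨(↑u⁻¹ : ℤ_[p]) * a, ?_⟩
  ext x
  simp only [fracBall, residueBall, Set.mem_ofPred_eq]
  have : (n : ℤ_[p]) * x - a = u * (x - (↑u⁻¹ : ℤ_[p]) * a) := by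
    rw [mul_sub, ← mul_assoc, Units.mul_inv, one_mul, hu]
  rw [this]
  exact Units.dvd_mul_left

theorem measurableSet_fracBall (p : ℕ) [Fact p.Prime] [MeasurableSpace ℤ_[p]]
    [BorelSpace ℤ_[p]] (k : ℕ) {n : ℕ} (hn : p.Coprime n) (a : ℕ) :
    MeasurableSet (fracBall p k n a) := by
  obtain ⟨c, hc⟩ := fracBall_eq_residueBall p k hn a
  rw [hc]
  exact measurableSet_residueBall p k c

theorem measure_fracBall (p : ℕ) [Fact p.Prime] [MeasurableSpace ℤ_[p]] [BorelSpace ℤ_[p]]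
    (μ : Measure ℤ_[p]) [μ.IsAddHaarMeasure] [IsProbabilityMeasure μ] (k : ℕ) {n : ℕ}
    (hn : p.Coprime n) (a : ℕ) : μ.real (fracBall p k n a) = ((p ^ k : ℕ) : ℝ)⁻¹ := by
  obtain ⟨c, hc⟩ := fracBall_eq_residueBall p k hn a
  rw [hc, measure_residueBall]

theorem dvd_of_mem_fracBall {p : ℕ} [Fact p.Prime] {k l n m a b : ℕ} (hkl : k ≤ l) {x : ℤ_[p]}
    (hx : x ∈ fracBall p k n a) (hy : x ∈ fracBall p l m b) :
    ((p ^ k : ℕ) : ℤ) ∣ a * m - b * n := by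
  have h2 : (p : ℤ_[p]) ^ k ∣ m * x - b := (pow_dvd_pow _ hkl).trans hy
  have h3 : (p : ℤ_[p]) ^ k ∣ ((a * m - b * n : ℤ) : ℤ_[p]) := by
    have : ((a * m - b * n : ℤ) : ℤ_[p]) = n * (m * x - b) - m * (n * x - a) := by
      push_cast; ring
    rw [this]
    exact dvd_sub (h2.mul_left _) (Dvd.dvd.mul_left hx _)
  rw [PadicInt.pow_p_dvd_int_iff] at h3
  exact_mod_cast h3

theorem sq_sum_measureReal_le {α ι : Type*} [MeasurableSpace α] (μ : Measure α)
    [IsFiniteMeasure μ] (I : Finset ι) (B : ι → Set α) (hB : ∀ i ∈ I, MeasurableSet (B i)) :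
    (∑ i ∈ I, μ.real (B i)) ^ 2 ≤
      μ.real (⋃ i ∈ I, B i) * ∑ i ∈ I, ∑ j ∈ I, μ.real (B i ∩ B j) := by
  classical
  set U := ⋃ i ∈ I, B i with hU
  have hUm : MeasurableSet U := Finset.measurableSet_biUnion I hB
  set Q := ∑ i ∈ I, μ.real (B i) with hQ
  set S := ∑ i ∈ I, ∑ j ∈ I, μ.real (B i ∩ B j) with hS
  have hInt : ∀ s : Set α, MeasurableSet s → Integrable (s.indicator (1 : α → ℝ)) μ :=
    fun s hs => (integrable_const (1 : ℝ)).indicator hs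
  have key : ∀ t : ℝ, 0 ≤ μ.real U * (t * t) + (-2 * Q) * t + S := by
    intro t
    have hexp : ∀ x, (∑ i ∈ I, (B i).indicator (1 : α → ℝ) x - t * U.indicator 1 x) ^ 2 =
        t * t * U.indicator 1 x + -2 * t * (∑ i ∈ I, (B i).indicator (1 : α → ℝ) x) +
          ∑ i ∈ I, ∑ j ∈ I, (B i ∩ B j).indicator (1 : α → ℝ) x := by
      intro x
      have h1 : ∑ i ∈ I, ∑ j ∈ I, (B i ∩ B j).indicator (1 : α → ℝ) x =
          (∑ i ∈ I, (B i).indicator (1 : α → ℝ) x) ^ 2 := by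
        rw [pow_two, Finset.sum_mul_sum]
        refine Finset.sum_congr rfl fun i _ => Finset.sum_congr rfl fun j _ => ?_
        rw [Set.inter_indicator_one]
        rfl
      have h2 : (∑ i ∈ I, (B i).indicator (1 : α → ℝ) x) * U.indicator 1 x =
          ∑ i ∈ I, (B i).indicator (1 : α → ℝ) x := by
        by_cases hx : x ∈ U
        · simp [hx]
        · rw [Finset.sum_eq_zero, zero_mul]
          intro i hi
          refine Set.indicator_of_notMem (fun h => hx ?_) _
          exact Set.mem_biUnion (s := (I : Set ι)) hi h
      have h3 : U.indicator (1 : α → ℝ) x * U.indicator 1 x = U.indicator 1 x := by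
        by_cases hx : x ∈ U <;> simp [hx]
      rw [h1]
      linear_combination (-2 * t) * h2 + t ^ 2 * h3
    have h0 : 0 ≤ ∫ x, (∑ i ∈ I, (B i).indicator (1 : α → ℝ) x - t * U.indicator 1 x) ^ 2 ∂μ :=
      integral_nonneg fun x => sq_nonneg _
    rw [integral_congr_ae (Eventually.of_forall hexp)] at h0
    have i1 : Integrable (fun x => t * t * U.indicator (1 : α → ℝ) x) μ :=
      (hInt U hUm).const_mul _
    have i2 : Integrable (fun x => ∑ i ∈ I, (B i).indicator (1 : α → ℝ) x) μ :=
      integrable_finsetSum _ fun i hi => hInt _ (hB i hi)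
    have i3 : Integrable (fun x => ∑ i ∈ I, ∑ j ∈ I, (B i ∩ B j).indicator (1 : α → ℝ) x) μ :=
      integrable_finsetSum _ fun i hi => integrable_finsetSum _ fun j hj =>
        hInt _ ((hB i hi).inter (hB j hj))
    have j2 : ∫ x, ∑ i ∈ I, (B i).indicator (1 : α → ℝ) x ∂μ = Q := by
      rw [integral_finsetSum _ fun i hi => hInt _ (hB i hi)]
      exact Finset.sum_congr rfl fun i hi => integral_indicator_one (hB i hi)
    have j3 : ∫ x, ∑ i ∈ I, ∑ j ∈ I, (B i ∩ B j).indicator (1 : α → ℝ) x ∂μ = S := by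
      rw [integral_finsetSum _ fun i hi => integrable_finsetSum _ fun j hj =>
        hInt _ ((hB i hi).inter (hB j hj))]
      refine Finset.sum_congr rfl fun i hi => ?_
      rw [integral_finsetSum _ fun j hj => hInt _ ((hB i hi).inter (hB j hj))]
      exact Finset.sum_congr rfl fun j hj => integral_indicator_one ((hB i hi).inter (hB j hj))
    have i12 : Integrable (fun x => t * t * U.indicator (1 : α → ℝ) x +
        -2 * t * (∑ i ∈ I, (B i).indicator (1 : α → ℝ) x)) μ := i1.add (i2.const_mul _)
    rw [integral_add i12 i3, integral_add i1 (i2.const_mul _), integral_const_mul,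
      integral_const_mul, integral_indicator_one hUm, j2, j3] at h0
    linarith
  have := discrim_le_zero key
  rw [discrim] at this
  linarith

/-- The numerators of the reduced fractions in `[0, 1)` with denominator `n`. -/
def reducedNumerators (n : ℕ) : Finset ℕ := (Finset.range n).filter n.Coprime

theorem card_reducedNumerators (n : ℕ) : (reducedNumerators n).card = n.totient := rfl

theorem mem_reducedNumerators {n a : ℕ} : a ∈ reducedNumerators n ↔ a < n ∧ n.Coprime a := by
  simp [reducedNumerators]

theorem card_closePairs_self_le {n K : ℕ} (hK : K.Coprime n) (hn : n ≤ K) :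
    (closePairs n n K).card ≤ n.totient := by
  rw [← card_reducedNumerators]
  refine Finset.card_le_card_of_injOn Prod.fst ?_ ?_
  · rintro ⟨a, b⟩ hx
    have := mem_closePairs.1 hx
    exact mem_reducedNumerators.2 ⟨this.1.1, this.2.1⟩
  · rintro ⟨a, b⟩ hx ⟨a', b'⟩ hy hxy
    have aux : ∀ {a b : ℕ}, (a, b) ∈ closePairs n n K → a = b := by
      intro a b h
      obtain ⟨⟨ha, hb⟩, -, -, h4⟩ := mem_closePairs.1 h
      rw [← sub_mul] at h4
      have h5 := (Nat.isCoprime_iff_coprime.2 hK).dvd_of_dvd_mul_right h4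
      have h6 : (a - b : ℤ) = 0 := by
        refine Int.eq_zero_of_abs_lt_dvd h5 ?_
        rw [abs_lt]
        constructor <;> omega
      omega
    have h1 := aux hx
    have h2 := aux hy
    simp only at hxy
    subst h1 h2 hxy
    rfl

section

variable (p : ℕ) [Fact p.Prime] [MeasurableSpace ℤ_[p]] [BorelSpace ℤ_[p]]
  (μ : Measure ℤ_[p]) [μ.IsAddHaarMeasure] [IsProbabilityMeasure μ]

theorem sum_measure_inter_fracBall_le {k l n m : ℕ} (hm : p.Coprime m) (hkl : k ≤ l) :
    ∑ a ∈ reducedNumerators n, ∑ b ∈ reducedNumerators m,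
      μ.real (fracBall p k n a ∩ fracBall p l m b) ≤
      (closePairs n m (p ^ k)).card * ((p ^ l : ℕ) : ℝ)⁻¹ := by
  classical
  rw [← Finset.sum_product', ← nsmul_eq_mul, ← Finset.sum_const, ← Finset.sum_subset (?_ :
    closePairs n m (p ^ k) ⊆ reducedNumerators n ×ˢ reducedNumerators m)]
  · refine Finset.sum_le_sum fun x _ => ?_
    rw [← measure_fracBall p μ l hm x.2]
    exact measureReal_mono Set.inter_subset_right
  · rintro ⟨a, b⟩ hx hx'
    rw [Finset.mem_product, mem_reducedNumerators, mem_reducedNumerators] at hx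
    rw [Set.eq_empty_of_forall_notMem (s := fracBall p k n a ∩ fracBall p l m b),
      measureReal_empty]
    rintro x ⟨hxa, hxb⟩
    exact hx' (mem_closePairs.2 ⟨⟨hx.1.1, hx.2.1⟩, hx.1.2, hx.2.2,
      dvd_of_mem_fracBall hkl hxa hxb⟩)
  · rintro ⟨a, b⟩ hx
    have := mem_closePairs.1 hx
    rw [Finset.mem_product, mem_reducedNumerators, mem_reducedNumerators]
    exact ⟨⟨this.1.1, this.2.1⟩, this.1.2, this.2.2.1⟩

theorem le_measure_iUnion_fracBall {F : Finset ℕ} {k : ℕ → ℕ} {C : ℝ} (hC0 : 0 ≤ C)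
    (hF0 : ∀ n ∈ F, n ≠ 0) (hp : ∀ n ∈ F, p.Coprime n)
    (hC : ∀ n ∈ F, (n : ℝ) ^ 2 ≤ C * (p ^ k n : ℕ)) (hle : ∀ n ∈ F, n ≤ p ^ k n)
    (hL : 1 ≤ ∑ n ∈ F, n.totient * ((p ^ k n : ℕ) : ℝ)⁻¹) :
    (1 + 6 * Real.exp 4 + 2 * overlapConst C)⁻¹ ≤
      μ.real (⋃ n ∈ F, ⋃ a ∈ reducedNumerators n, fracBall p (k n) n a) := by
  classical
  set L := ∑ n ∈ F, n.totient * ((p ^ k n : ℕ) : ℝ)⁻¹ with hLdef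
  have hcop : ∀ n ∈ F, ∀ m ∈ F, (p ^ k n).Coprime m := fun n _ m hm => (hp m hm).pow_left _
  have hov : 0 ≤ overlapConst C := by
    have := sparseConst_pos
    unfold overlapConst
    positivity
  set T : ℕ → ℕ → ℝ := fun n m => ∑ a ∈ reducedNumerators n, ∑ b ∈ reducedNumerators m,
      μ.real (fracBall p (k n) n a ∩ fracBall p (k m) m b) with hT
  have hTsymm : ∀ n m, T n m = T m n := by
    intro n m
    simp only [hT]
    rw [Finset.sum_comm]
    simp only [Set.inter_comm]
  set g : ℕ → ℕ → ℝ := fun n m => if n = m then 0 else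
    ((closePairs n m (p ^ k n)).card : ℝ) * ((p ^ k m : ℕ) : ℝ)⁻¹ with hg
  have hg0 : ∀ n m, 0 ≤ g n m := by
    intro n m
    simp only [hg]
    split_ifs <;> positivity
  have hTle : ∀ n ∈ F, ∀ m ∈ F, T n m ≤
      (if n = m then n.totient * ((p ^ k n : ℕ) : ℝ)⁻¹ else 0) + (g n m + g m n) := by
    intro n hn m hm
    by_cases hnm : n = m
    · subst hnm
      rw [if_pos rfl]
      have h1 := sum_measure_inter_fracBall_le p μ (n := n) (hp n hn) (le_refl (k n))
      have h2 : ((closePairs n n (p ^ k n)).card : ℝ) * ((p ^ k n : ℕ) : ℝ)⁻¹ ≤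
          n.totient * ((p ^ k n : ℕ) : ℝ)⁻¹ := by
        gcongr
        exact card_closePairs_self_le (hcop n hn n hn) (hle n hn)
      linarith [hg0 n n]
    · rw [if_neg hnm, zero_add]
      rcases le_total (k n) (k m) with h | h
      · have h1 : T n m ≤ g n m := by
          simp only [hg, if_neg hnm]
          exact sum_measure_inter_fracBall_le p μ (hp m hm) h
        linarith [hg0 m n]
      · have h1 : T m n ≤ g m n := by
          simp only [hg, if_neg (Ne.symm hnm)]
          exact sum_measure_inter_fracBall_le p μ (hp n hn) h
        rw [hTsymm]
        linarith [hg0 n m]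
  have hpairs : ∑ n ∈ F, ∑ m ∈ F, g n m ≤ 3 * Real.exp 4 * L ^ 2 + overlapConst C * L :=
    sum_closePairs_le (K := fun n => p ^ k n) hC0 hF0
      (fun n => pow_pos (Fact.out : p.Prime).pos _) hC hcop
  have hS : ∑ n ∈ F, ∑ m ∈ F, T n m ≤ L + 2 * (3 * Real.exp 4 * L ^ 2 + overlapConst C * L) := by
    refine (Finset.sum_le_sum fun n hn => Finset.sum_le_sum fun m hm => hTle n hn m hm).trans ?_
    simp only [Finset.sum_add_distrib]
    have h1 : ∑ n ∈ F, ∑ m ∈ F, (if n = m then n.totient * ((p ^ k n : ℕ) : ℝ)⁻¹ else 0) = L := by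
      refine Finset.sum_congr rfl fun n hn => ?_
      rw [Finset.sum_ite_eq, if_pos hn]
    have h2 : ∑ n ∈ F, ∑ m ∈ F, g m n = ∑ n ∈ F, ∑ m ∈ F, g n m := Finset.sum_comm
    rw [h1, h2]
    linarith
  set B : (Σ _ : ℕ, ℕ) → Set ℤ_[p] := fun i => fracBall p (k i.1) i.1 i.2 with hB
  have key := sq_sum_measureReal_le μ (F.sigma reducedNumerators) B (fun i hi =>
    measurableSet_fracBall p _ (hp _ (Finset.mem_sigma.1 hi).1) _)
  have hQ : ∑ i ∈ F.sigma reducedNumerators, μ.real (B i) = L := by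
    rw [Finset.sum_sigma]
    refine Finset.sum_congr rfl fun n hn => ?_
    rw [Finset.sum_congr rfl fun a _ => measure_fracBall p μ (k n) (hp n hn) a, Finset.sum_const,
      card_reducedNumerators, nsmul_eq_mul]
  have hSS : ∑ i ∈ F.sigma reducedNumerators, ∑ j ∈ F.sigma reducedNumerators,
      μ.real (B i ∩ B j) = ∑ n ∈ F, ∑ m ∈ F, T n m := by
    rw [Finset.sum_sigma]
    refine Finset.sum_congr rfl fun n _ => ?_
    simp only [Finset.sum_sigma]
    rw [Finset.sum_comm]
  have hU : ⋃ i ∈ F.sigma reducedNumerators, B i =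
      ⋃ n ∈ F, ⋃ a ∈ reducedNumerators n, fracBall p (k n) n a := by
    ext x
    simp only [Set.mem_iUnion, Finset.mem_sigma, hB]
    constructor
    · rintro ⟨i, hi, hx⟩
      exact ⟨i.1, hi.1, i.2, hi.2, hx⟩
    · rintro ⟨n, hn, a, ha, hx⟩
      exact ⟨⟨n, a⟩, ⟨hn, ha⟩, hx⟩
  rw [hQ, hSS, hU] at key
  set u := μ.real (⋃ n ∈ F, ⋃ a ∈ reducedNumerators n, fracBall p (k n) n a) with hu
  have hu0 : 0 ≤ u := measureReal_nonneg
  have hE := Real.exp_pos 4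
  have hbound : ∑ n ∈ F, ∑ m ∈ F, T n m ≤ L ^ 2 * (1 + 6 * Real.exp 4 + 2 * overlapConst C) := by
    have h1 : L ≤ L ^ 2 := by nlinarith
    have h2 : overlapConst C * L ≤ overlapConst C * L ^ 2 := mul_le_mul_of_nonneg_left h1 hov
    linarith
  have h3 : L ^ 2 * 1 ≤ L ^ 2 * (u * (1 + 6 * Real.exp 4 + 2 * overlapConst C)) := by
    calc L ^ 2 * 1 ≤ u * (L ^ 2 * (1 + 6 * Real.exp 4 + 2 * overlapConst C)) := by
          rw [mul_one]
          exact key.trans (mul_le_mul_of_nonneg_left hbound hu0)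
      _ = _ := by ring
  have h4 := le_of_mul_le_mul_left h3 (by positivity)
  rw [inv_le_iff_one_le_mul₀ (by positivity)]
  exact h4

end

theorem range_pow_mul (p : ℕ) [Fact p.Prime] (i : ℕ) :
    (Set.range fun y : ℤ_[p] => (p : ℤ_[p]) ^ i * y) = residueBall p i 0 := by
  ext x
  simp only [Set.mem_range, residueBall, Set.mem_ofPred_eq, sub_zero]
  exact ⟨fun ⟨y, hy⟩ => ⟨y, hy.symm⟩, fun ⟨y, hy⟩ => ⟨y, hy.symm⟩⟩

section

variable (p : ℕ) [Fact p.Prime] [MeasurableSpace ℤ_[p]] [BorelSpace ℤ_[p]]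
  (μ : Measure ℤ_[p]) [μ.IsAddHaarMeasure] [IsProbabilityMeasure μ]

theorem measurableEmbedding_pow_mul (i : ℕ) :
    MeasurableEmbedding fun y : ℤ_[p] => (p : ℤ_[p]) ^ i * y := by
  refine (Continuous.isClosedEmbedding (by fun_prop) ?_).measurableEmbedding
  exact mul_right_injective₀ (pow_ne_zero _ (NeZero.ne _))

theorem measure_image_pow_mul (i : ℕ) (A : Set ℤ_[p]) :
    μ ((fun y : ℤ_[p] => (p : ℤ_[p]) ^ i * y) '' A) = μ (residueBall p i 0) * μ A := by
  set f : ℤ_[p] → ℤ_[p] := fun y => (p : ℤ_[p]) ^ i * y with hf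
  have hfe : MeasurableEmbedding f := measurableEmbedding_pow_mul p i
  set ν := μ.comap f with hν
  have hν_apply : ∀ s, ν s = μ (f '' s) := fun s => hfe.comap_apply μ s
  have : IsFiniteMeasure ν := ⟨by rw [hν_apply]; exact measure_lt_top _ _⟩
  have : ν.IsAddLeftInvariant := by
    refine ⟨fun g => Measure.ext fun s hs => ?_⟩
    rw [Measure.map_apply (measurable_const_add g) hs, hν_apply, hν_apply,
      ← measure_preimage_add μ (f g) (f '' s)]
    congr 1
    ext x
    constructor
    · rintro ⟨y, hy, rfl⟩
      exact ⟨g + y, hy, by simp only [hf]; ring⟩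
    · rintro ⟨y, hy, hxy⟩
      refine ⟨y - g, by simpa using hy, ?_⟩
      simp only [hf] at hxy ⊢
      rw [mul_sub, hxy]
      ring
  have h1 := Measure.isAddInvariant_eq_smul_of_compactSpace ν μ
  have h2 : ∀ s, μ (f '' s) = Measure.addHaarScalarFactor ν μ * μ s := by
    intro s
    rw [← hν_apply]
    conv_lhs => rw [h1]
    rfl
  have h3 := h2 Set.univ
  rw [Set.image_univ, range_pow_mul, measure_univ, mul_one] at h3
  rw [h2, h3]

theorem measure_image_add_pow_mul (i : ℕ) (b : ℤ_[p]) (A : Set ℤ_[p]) :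
    μ ((fun y : ℤ_[p] => b + (p : ℤ_[p]) ^ i * y) '' A) = μ (residueBall p i b) * μ A := by
  have h1 : (fun y : ℤ_[p] => b + (p : ℤ_[p]) ^ i * y) '' A =
      (fun y => b + y) '' ((fun y : ℤ_[p] => (p : ℤ_[p]) ^ i * y) '' A) := by
    rw [Set.image_image]
  have h2 : μ (residueBall p i b) = μ (residueBall p i 0) := by
    rw [← ENNReal.toReal_eq_toReal_iff' (measure_ne_top _ _) (measure_ne_top _ _)]
    exact (measure_residueBall p μ i b).trans (measure_residueBall p μ i 0).symm
  rw [h1, Set.image_add_left, measure_preimage_add, measure_image_pow_mul, h2]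

theorem measure_inter_isOpen_le {W U : Set ℤ_[p]} (hU : IsOpen U)
    (hW : ∀ i b : ℕ, b < p ^ i → ∀ y : ℤ_[p], b + (p : ℤ_[p]) ^ i * y ∈ W → y ∈ W) :
    μ (W ∩ U) ≤ μ W * μ U := by
  classical
  set Z : ℕ → Finset ℕ := fun i =>
    (Finset.range (p ^ i)).filter fun b => residueBall p i (b : ℤ_[p]) ⊆ U with hZ
  set V : ℕ → Set ℤ_[p] := fun i => ⋃ b ∈ Z i, residueBall p i (b : ℤ_[p]) with hV
  have hmemV : ∀ i x, x ∈ V i ↔ residueBall p i x ⊆ U := by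
    intro i x
    have haux : ∀ {x y : ℤ_[p]}, x ∈ residueBall p i y → residueBall p i x = residueBall p i y := by
      intro x y hxy
      ext z
      simp only [residueBall, Set.mem_ofPred_eq] at hxy ⊢
      rw [show z - y = (z - x) + (x - y) by ring]
      exact (dvd_add_left hxy).symm
    simp only [hV, hZ, Set.mem_iUnion, Finset.mem_filter, Finset.mem_range]
    constructor
    · rintro ⟨b, hb, hx⟩
      rw [haux hx]
      exact hb.2
    · intro h
      have hx : x ∈ residueBall p i (x.appr i : ℤ_[p]) :=
        Ideal.mem_span_singleton.1 (PadicInt.appr_spec i x)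
      exact ⟨x.appr i, ⟨PadicInt.appr_lt x i, haux hx ▸ h⟩, hx⟩
  have hmono : Monotone V := by
    intro i j hij x hx
    rw [hmemV] at hx ⊢
    exact fun y hy => hx ((pow_dvd_pow _ hij).trans hy)
  have hUnion : ⋃ i, V i = U := by
    ext x
    simp only [Set.mem_iUnion, hmemV]
    constructor
    · rintro ⟨i, hi⟩
      exact hi (by simp [residueBall])
    · intro hx
      obtain ⟨ε, hε, hball⟩ := Metric.isOpen_iff.1 hU x hx
      obtain ⟨i, hi⟩ := PadicInt.exists_pow_neg_lt p hε
      refine ⟨i, ?_⟩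
      rw [residueBall_eq_closedBall]
      exact (Metric.closedBall_subset_ball hi).trans hball
  have hball : ∀ i, ∀ b ∈ Z i, μ (W ∩ residueBall p i (b : ℤ_[p])) ≤
      μ W * μ (residueBall p i (b : ℤ_[p])) := by
    intro i b hb
    rw [mul_comm, ← measure_image_add_pow_mul p μ i b W]
    refine measure_mono ?_
    rintro x ⟨hxW, y, hy⟩
    have hx : x = b + (p : ℤ_[p]) ^ i * y := by rw [← hy]; ring
    exact ⟨y, hW i b (Finset.mem_range.1 (Finset.mem_filter.1 hb).1) y (hx ▸ hxW), hx.symm⟩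
  have hlevel : ∀ i, μ (W ∩ V i) ≤ μ W * μ U := by
    intro i
    calc μ (W ∩ V i) ≤ ∑ b ∈ Z i, μ (W ∩ residueBall p i (b : ℤ_[p])) := by
          simp only [hV, Set.inter_iUnion]
          exact measure_biUnion_finset_le _ _
      _ ≤ ∑ b ∈ Z i, μ W * μ (residueBall p i (b : ℤ_[p])) := Finset.sum_le_sum (hball i)
      _ = μ W * μ (V i) := by
          rw [← Finset.mul_sum, hV, measure_biUnion_finset
            ((pairwiseDisjoint_residueBall p i).subset (Finset.filter_subset _ _))
            fun b _ => measurableSet_residueBall p i _]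
      _ ≤ μ W * μ U := by
          gcongr
          rw [← hUnion]
          exact Set.subset_iUnion V i
  rw [← hUnion, Set.inter_iUnion, hUnion, Monotone.measure_iUnion
    fun i j hij => Set.inter_subset_inter_right W (hmono hij)]
  exact iSup_le hlevel

theorem measure_eq_one_of_selfSimilar {W : Set ℤ_[p]} (h0 : μ W ≠ 0)
    (hW : ∀ i b : ℕ, b < p ^ i → ∀ y : ℤ_[p], b + (p : ℤ_[p]) ^ i * y ∈ W → y ∈ W) :
    μ W = 1 := by
  refine le_antisymm prob_le_one ?_
  rw [Set.measure_eq_iInf_isOpen]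
  refine le_iInf₂ fun U hWU => le_iInf fun hU => ?_
  have h1 := measure_inter_isOpen_le p μ hU hW
  rw [Set.inter_eq_left.2 hWU] at h1
  have h2 : μ W * 1 ≤ μ W * μ U := by rwa [mul_one]
  exact (ENNReal.mul_le_mul_iff_right h0 (measure_ne_top _ _)).1 h2

end

theorem norm_natCast_mul_sub (p : ℕ) [Fact p.Prime] {n : ℕ} (hn : n ≠ 0) (x : ℤ_[p]) (a : ℤ) :
    ‖(n : ℤ_[p]) * x - a‖ = ‖(n : ℤ_[p])‖ * ‖(x : ℚ_[p]) - (a : ℚ_[p]) / (n : ℚ_[p])‖ := by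
  have hn' : (n : ℚ_[p]) ≠ 0 := by exact_mod_cast hn
  rw [PadicInt.norm_def, PadicInt.norm_def, ← norm_mul]
  push_cast
  congr 1
  field_simp

theorem pow_dvd_of_norm_le {p : ℕ} [Fact p.Prime] {n k : ℕ} (hn : n ≠ 0) {x : ℤ_[p]} {a : ℤ}
    (h : ‖(x : ℚ_[p]) - (a : ℚ_[p]) / (n : ℚ_[p])‖ ≤ ((p : ℝ) ^ k)⁻¹) :
    (p : ℤ_[p]) ^ k ∣ n * x - a := by
  rw [← Ideal.mem_span_singleton, ← PadicInt.norm_le_pow_iff_mem_span_pow,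
    norm_natCast_mul_sub p hn, zpow_neg, zpow_natCast]
  exact (mul_le_of_le_one_left (norm_nonneg _) (PadicInt.norm_le_one _)).trans h

theorem fracBall_subset_padicE (p : ℕ) [Fact p.Prime] {ψ : ℕ → ℝ} {n k a : ℕ}
    (hn : n ≠ 0) (hpn : p.Coprime n) (hk : ((p ^ k : ℕ) : ℝ)⁻¹ ≤ ψ n)
    (ha : a ∈ reducedNumerators n) : fracBall p k n a ⊆ padicE p ψ n := by
  intro x hx
  rw [mem_reducedNumerators] at ha
  refine ⟨a, ?_, ?_, ?_⟩
  · rw [Nat.abs_cast]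
    exact_mod_cast ha.1.le
  · rw [Int.gcd_natCast_natCast]
    exact ha.2.symm
  · have h1 := norm_natCast_mul_sub p hn x a
    rw [PadicInt.norm_natCast_eq_one_iff.2 hpn, one_mul] at h1
    rw [← h1]
    refine le_trans ?_ hk
    have h2 := (PadicInt.norm_le_pow_iff_mem_span_pow ((n : ℤ_[p]) * x - ((a : ℤ) : ℤ_[p])) k).2
      (Ideal.mem_span_singleton.2 (by rw [Int.cast_natCast]; exact hx))
    rw [zpow_neg, zpow_natCast] at h2
    exact_mod_cast h2

theorem padicE_eq_empty {p : ℕ} [Fact p.Prime] {ψ : ℕ → ℝ} {n : ℕ} (hn : n ≠ 0)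
    (hψ : ψ n < 1) (hpn : p ∣ n) : padicE p ψ n = ∅ := by
  refine Set.eq_empty_of_forall_notMem ?_
  rintro x ⟨a, -, hgcd, hx⟩
  have h1 : ‖(n : ℤ_[p]) * x - a‖ < 1 := by
    rw [norm_natCast_mul_sub p hn]
    exact (mul_le_of_le_one_left (norm_nonneg _) (PadicInt.norm_le_one _)).trans_lt
      (hx.trans_lt hψ)
  rw [PadicInt.norm_lt_one_iff_dvd] at h1
  have h2 : (p : ℤ_[p]) ∣ (a : ℤ_[p]) := by
    obtain ⟨m, rfl⟩ := hpn
    have h3 : (p : ℤ_[p]) ∣ ((p * m : ℕ) : ℤ_[p]) * x := by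
      push_cast
      exact ⟨m * x, by ring⟩
    exact (dvd_sub_right h3).1 h1
  have h3 : (p : ℤ) ∣ a := by
    have := (PadicInt.pow_p_dvd_int_iff (p := p) 1 a).1 (by simpa using h2)
    simpa using this
  have h4 : p ∣ Int.gcd a n := Int.dvd_gcd h3 (Int.natCast_dvd_natCast.2 hpn)
  rw [hgcd] at h4
  exact (Fact.out : p.Prime).one_lt.ne' (Nat.dvd_one.1 h4)

theorem measurableSet_padicE (p : ℕ) [Fact p.Prime] [MeasurableSpace ℤ_[p]] [BorelSpace ℤ_[p]]
    (ψ : ℕ → ℝ) (n : ℕ) : MeasurableSet (padicE p ψ n) := by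
  have h : padicE p ψ n = ⋃ a : ℤ, ⋃ (_ : |a| ≤ (n : ℤ) ∧ Int.gcd a n = 1),
      {x : ℤ_[p] | ‖(x : ℚ_[p]) - (a : ℚ_[p]) / (n : ℚ_[p])‖ ≤ ψ n} := by
    ext x
    simp [padicE, and_assoc]
  rw [h]
  refine MeasurableSet.iUnion fun a => MeasurableSet.iUnion fun _ => IsClosed.measurableSet ?_
  exact isClosed_le (by fun_prop) continuous_const

theorem padicW_eq (p : ℕ) [Fact p.Prime] (ψ : ℕ → ℝ) :
    padicW p ψ = ⋂ N : ℕ, ⋃ n ≥ N, padicE p ψ n := by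
  ext x
  simp only [padicW, Set.mem_ofPred_eq, Set.mem_iInter, Set.mem_iUnion, exists_prop, ge_iff_le]
  rw [← Nat.frequently_atTop_iff_infinite, frequently_atTop]

section

variable (p : ℕ) [Fact p.Prime] [MeasurableSpace ℤ_[p]] [BorelSpace ℤ_[p]]

theorem measurableSet_iUnion_padicE (ψ : ℕ → ℝ) (N : ℕ) :
    MeasurableSet (⋃ n ≥ N, padicE p ψ n) :=
  MeasurableSet.iUnion fun n => MeasurableSet.iUnion fun _ => measurableSet_padicE p ψ n

theorem measurableSet_padicW (ψ : ℕ → ℝ) : MeasurableSet (padicW p ψ) := by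
  rw [padicW_eq]
  exact MeasurableSet.iInter fun N => measurableSet_iUnion_padicE p ψ N

variable (μ : Measure ℤ_[p]) [μ.IsAddHaarMeasure] [IsProbabilityMeasure μ]

theorem measure_padicE_le {ψ : ℕ → ℝ} {n k : ℕ} (hn : 2 ≤ n) (hpn : p.Coprime n)
    (hk : ψ n ≤ ((p ^ k : ℕ) : ℝ)⁻¹) :
    μ.real (padicE p ψ n) ≤ 2 * (n.totient * ((p ^ k : ℕ) : ℝ)⁻¹) := by
  set U := ⋃ a ∈ reducedNumerators n, fracBall p k n a with hU
  have hUle : μ.real U ≤ n.totient * ((p ^ k : ℕ) : ℝ)⁻¹ := by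
    refine (measureReal_biUnion_finset_le _ _).trans_eq ?_
    rw [Finset.sum_congr rfl fun a _ => measure_fracBall p μ k hpn a, Finset.sum_const,
      card_reducedNumerators, nsmul_eq_mul]
  have hsub : padicE p ψ n ⊆ U ∪ (fun x => x + 1) ⁻¹' U := by
    rintro x ⟨a, ha, hgcd, hx⟩
    have hdvd : (p : ℤ_[p]) ^ k ∣ n * x - a :=
      pow_dvd_of_norm_le (by omega) (hx.trans (by exact_mod_cast hk))
    have hne : a ≠ n ∧ a ≠ -n := by
      constructor <;> rintro rfl <;> simp at hgcd <;> omega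
    rw [abs_le] at ha
    have hcop : IsCoprime a (n : ℤ) := Int.isCoprime_iff_gcd_eq_one.2 hgcd
    rcases le_or_gt 0 a with h | h
    · lift a to ℕ using h
      refine Or.inl (Set.mem_biUnion (x := a) ?_ ?_)
      swap
      · show (p : ℤ_[p]) ^ k ∣ n * x - (a : ℤ_[p])
        exact_mod_cast hdvd
      rw [Finset.mem_coe, mem_reducedNumerators]
      exact ⟨by omega, (Nat.isCoprime_iff_coprime.1 hcop).symm⟩
    · obtain ⟨b, hb⟩ : ∃ b : ℕ, (b : ℤ) = a + n := ⟨(a + n).toNat, by omega⟩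
      refine Or.inr (Set.mem_biUnion (x := b) ?_ ?_)
      · rw [Finset.mem_coe, mem_reducedNumerators]
        refine ⟨by omega, ?_⟩
        rw [← Nat.isCoprime_iff_coprime, hb]
        have h1 : IsCoprime (a + n * 1) (n : ℤ) := hcop.add_mul_left_left 1
        rw [mul_one] at h1
        exact h1.symm
      · have h1 : (b : ℤ_[p]) = a + n := by exact_mod_cast congrArg (Int.cast (R := ℤ_[p])) hb
        show (p : ℤ_[p]) ^ k ∣ n * (x + 1) - b
        rw [h1]
        convert hdvd using 1
        ring
  have htrans : μ.real ((fun x => x + 1) ⁻¹' U) = μ.real U := by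
    rw [measureReal_def, measure_preimage_add_right, ← measureReal_def]
  calc μ.real (padicE p ψ n) ≤ μ.real U + μ.real ((fun x => x + 1) ⁻¹' U) :=
        (measureReal_mono hsub).trans (measureReal_union_le _ _)
    _ ≤ 2 * (n.totient * ((p ^ k : ℕ) : ℝ)⁻¹) := by rw [htrans]; linarith

theorem measure_padicE_eq_zero {ψ : ℕ → ℝ} {n : ℕ} (hn : 2 ≤ n) (hpn : p.Coprime n)
    (h0 : ψ n = 0) : μ.real (padicE p ψ n) = 0 := by
  refine le_antisymm ?_ measureReal_nonneg
  have h1 : Tendsto (fun k : ℕ => 2 * (n.totient * ((p ^ k : ℕ) : ℝ)⁻¹)) atTop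
      (nhds (2 * (n.totient * 0))) := by
    refine Tendsto.const_mul _ (Tendsto.const_mul _ ?_)
    have h2 := tendsto_pow_atTop_nhds_zero_of_lt_one (r := (p : ℝ)⁻¹) (by positivity)
      (inv_lt_one_of_one_lt₀ (by exact_mod_cast (Fact.out : p.Prime).one_lt))
    refine h2.congr fun k => ?_
    push_cast
    rw [inv_pow]
  simp only [mul_zero] at h1
  refine ge_of_tendsto' h1 fun k => measure_padicE_le p μ hn hpn ?_
  rw [h0]
  positivity

theorem le_measure_padicW {ψ : ℕ → ℝ} {S : Set ℕ} {k : ℕ → ℕ} {C : ℝ} (hC0 : 0 ≤ C)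
    (hS0 : ∀ n ∈ S, n ≠ 0) (hp : ∀ n ∈ S, p.Coprime n)
    (hC : ∀ n ∈ S, (n : ℝ) ^ 2 ≤ C * (p ^ k n : ℕ)) (hle : ∀ n ∈ S, n ≤ p ^ k n)
    (hψ : ∀ n ∈ S, ((p ^ k n : ℕ) : ℝ)⁻¹ ≤ ψ n)
    (hdiv : ¬ Summable (S.indicator fun n => n.totient * ((p ^ k n : ℕ) : ℝ)⁻¹)) :
    ENNReal.ofReal (1 + 6 * Real.exp 4 + 2 * overlapConst C)⁻¹ ≤ μ (padicW p ψ) := by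
  classical
  have hanti : Antitone fun N : ℕ => ⋃ n ≥ N, padicE p ψ n := by
    intro N M hNM
    exact Set.biUnion_subset_biUnion_left fun n hn => le_trans hNM hn
  rw [padicW_eq, hanti.measure_iInter
    (fun N => (measurableSet_iUnion_padicE p ψ N).nullMeasurableSet) ⟨0, measure_ne_top _ _⟩]
  refine le_iInf fun N => ?_
  set f : ℕ → ℝ := S.indicator fun n => n.totient * ((p ^ k n : ℕ) : ℝ)⁻¹ with hf
  have hf0 : ∀ n, 0 ≤ f n := fun n => Set.indicator_nonneg (fun _ _ => by positivity) n
  rw [not_summable_iff_tendsto_nat_atTop_of_nonneg hf0] at hdiv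
  obtain ⟨M, hM⟩ := (hdiv.eventually_ge_atTop (∑ i ∈ Finset.range N, f i + 1)).exists
  set F : Finset ℕ := (Finset.range M).filter fun n => n ∈ S ∧ N ≤ n with hF
  have hFS : ∀ n ∈ F, n ∈ S := fun n hn => (Finset.mem_filter.1 hn).2.1
  have hL : 1 ≤ ∑ n ∈ F, n.totient * ((p ^ k n : ℕ) : ℝ)⁻¹ := by
    have h1 : ∑ n ∈ Finset.range M, f n ≤ ∑ n ∈ F, f n + ∑ n ∈ Finset.range N, f n := by
      rw [← Finset.sum_filter_add_sum_filter_not (Finset.range M) (fun n => n ∈ S ∧ N ≤ n)]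
      refine add_le_add le_rfl ?_
      rw [← Finset.sum_filter_add_sum_filter_not
        ((Finset.range M).filter fun n => ¬ (n ∈ S ∧ N ≤ n)) (fun n => n ∈ S)]
      rw [Finset.sum_eq_zero (s := Finset.filter (fun n => n ∉ S) _), add_zero]
      · refine Finset.sum_le_sum_of_subset_of_nonneg ?_ fun n _ _ => hf0 n
        intro n hn
        simp only [Finset.mem_filter, Finset.mem_range] at hn ⊢
        by_contra h
        exact hn.1.2 ⟨hn.2, by omega⟩
      · intro n hn
        exact Set.indicator_of_notMem (Finset.mem_filter.1 hn).2 _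
    have h2 : ∑ n ∈ F, f n = ∑ n ∈ F, n.totient * ((p ^ k n : ℕ) : ℝ)⁻¹ :=
      Finset.sum_congr rfl fun n hn => Set.indicator_of_mem (hFS n hn) _
    linarith
  have key := le_measure_iUnion_fracBall p μ hC0 (fun n hn => hS0 n (hFS n hn))
    (fun n hn => hp n (hFS n hn)) (fun n hn => hC n (hFS n hn)) (fun n hn => hle n (hFS n hn)) hL
  refine (ENNReal.ofReal_le_ofReal key).trans ?_
  rw [ofReal_measureReal (measure_ne_top _ _)]
  refine measure_mono (Set.iUnion₂_subset fun n hn => Set.iUnion₂_subset fun a ha => ?_)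
  refine (fracBall_subset_padicE p (hS0 n (hFS n hn)) (hp n (hFS n hn)) (hψ n (hFS n hn)) ha).trans ?_
  exact Set.subset_biUnion_of_mem (u := fun n => padicE p ψ n) (Finset.mem_filter.1 hn).2.2

end

theorem exists_pow_inv_lt_le {p : ℕ} (hp : p.Prime) {r : ℝ} (h0 : 0 < r) (h1 : r ≤ 1) :
    ∃ k : ℕ, ((p ^ k : ℕ) : ℝ)⁻¹ < r ∧ r ≤ p * ((p ^ k : ℕ) : ℝ)⁻¹ := by
  have hp1 : (1 : ℝ) < p := by exact_mod_cast hp.one_lt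
  have hp0 : (0 : ℝ) < p := by linarith
  obtain ⟨m, hm1, hm2⟩ := exists_nat_pow_near_of_lt_one h0 h1 (inv_pos.2 hp0)
    (inv_lt_one_of_one_lt₀ hp1)
  refine ⟨m + 1, ?_, ?_⟩
  · rw [inv_pow] at hm1
    exact_mod_cast hm1
  · refine hm2.trans_eq ?_
    push_cast
    rw [inv_pow, pow_succ']
    field_simp

theorem padicE_mono (p : ℕ) [Fact p.Prime] {ψ φ : ℕ → ℝ} {n : ℕ} (h : ψ n ≤ φ n) :
    padicE p ψ n ⊆ padicE p φ n :=
  fun _ ⟨a, h1, h2, h3⟩ => ⟨a, h1, h2, h3.trans h⟩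

theorem padicW_mono (p : ℕ) [Fact p.Prime] {ψ φ : ℕ → ℝ} (h : ∀ n, ψ n ≤ φ n) :
    padicW p ψ ⊆ padicW p φ :=
  fun _ hx => Set.Infinite.mono (fun n hn => padicE_mono p (h n) hn) hx

theorem mem_padicE_of_add_mul_mem {p : ℕ} [Fact p.Prime] {ψ : ℕ → ℝ} {n i j b : ℕ}
    (hn : n ≠ 0) (hψ : ψ n ≤ 1) (hb : b < p ^ i) {y : ℤ_[p]}
    (h : (b : ℤ_[p]) + (p : ℤ_[p]) ^ i * y ∈ padicE p (fun m => ψ m / p ^ (i + j)) n) :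
    y ∈ padicE p (fun m => ψ m / p ^ j) n := by
  have hp1 : (1 : ℝ) < p := by exact_mod_cast (Fact.out : p.Prime).one_lt
  have hp0 : (0 : ℝ) < p := by linarith
  have hpp : (p : ℚ_[p]) ≠ 0 := by exact_mod_cast (Fact.out : p.Prime).ne_zero
  have hnn : (n : ℚ_[p]) ≠ 0 := by exact_mod_cast hn
  obtain ⟨a, ha, hgcd, hx⟩ := h
  have hdvd : (p : ℤ_[p]) ^ i ∣ n * (b + (p : ℤ_[p]) ^ i * y) - a := by
    refine pow_dvd_of_norm_le hn (hx.trans ?_)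
    simp only [div_eq_mul_inv]
    rw [← one_mul ((p : ℝ) ^ i)⁻¹]
    refine mul_le_mul hψ ?_ (by positivity) zero_le_one
    exact inv_anti₀ (by positivity) (pow_le_pow_right₀ hp1.le (by omega))
  have hdvd2 : (p : ℤ_[p]) ^ i ∣ ((a - b * n : ℤ) : ℤ_[p]) := by
    have h1 : ((a - b * n : ℤ) : ℤ_[p]) =
        (p : ℤ_[p]) ^ i * (n * y) - (n * (b + (p : ℤ_[p]) ^ i * y) - a) := by
      push_cast
      ring
    rw [h1]
    exact dvd_sub (dvd_mul_right _ _) hdvd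
  obtain ⟨c, hc⟩ := (PadicInt.pow_p_dvd_int_iff (p := p) i _).1 (by exact_mod_cast hdvd2)
  rw [Nat.cast_mul] at hc
  have hac : a = p ^ i * c + b * n := by linarith
  refine ⟨c, ?_, ?_, ?_⟩
  · have hq : (0 : ℤ) < (p : ℤ) ^ i := by
      have := (Fact.out : p.Prime).pos
      positivity
    have hb' : (b : ℤ) + 1 ≤ (p : ℤ) ^ i := by exact_mod_cast hb
    have h1 : (p : ℤ) ^ i * |c| ≤ (p : ℤ) ^ i * n := by
      rw [← abs_of_pos hq, ← abs_mul, abs_of_pos hq, ← hc]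
      calc |a - b * n| ≤ |a| + |(b : ℤ) * n| := abs_sub _ _
        _ ≤ n + b * n := by
          rw [abs_of_nonneg (by positivity : (0 : ℤ) ≤ b * n)]
          linarith
        _ = (b + 1) * n := by ring
        _ ≤ (p : ℤ) ^ i * n := by gcongr
    exact le_of_mul_le_mul_left h1 hq
  · rw [← Int.isCoprime_iff_gcd_eq_one] at hgcd ⊢
    rw [hac] at hgcd
    have h1 : IsCoprime ((p : ℤ) ^ i * c) (n : ℤ) := IsCoprime.of_add_mul_right_left hgcd
    exact h1.of_mul_left_right
  · have h1 : (((b : ℤ_[p]) + (p : ℤ_[p]) ^ i * y : ℤ_[p]) : ℚ_[p]) - (a : ℚ_[p]) / n =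
        (p : ℚ_[p]) ^ i * ((y : ℚ_[p]) - (c : ℚ_[p]) / n) := by
      rw [hac]
      push_cast
      field_simp
      ring
    rw [h1, norm_mul, norm_pow, Padic.norm_p, inv_pow, pow_add,
      inv_mul_le_iff₀ (by positivity)] at hx
    refine hx.trans_eq ?_
    field_simp

theorem mem_iInter_padicW_of_add_mul_mem {p : ℕ} [Fact p.Prime] {ψ : ℕ → ℝ} {N : ℕ}
    (hN : N ≠ 0) (hψ : ∀ n, N ≤ n → ψ n ≤ 1) {i b : ℕ} (hb : b < p ^ i)
    {y : ℤ_[p]} (h : (b : ℤ_[p]) + (p : ℤ_[p]) ^ i * y ∈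
      ⋂ j : ℕ, padicW p (fun n => ψ n / p ^ j)) :
    y ∈ ⋂ j : ℕ, padicW p (fun n => ψ n / p ^ j) := by
  rw [Set.mem_iInter] at h ⊢
  intro j
  refine ((h (i + j)).sdiff (Set.finite_lt_nat N)).mono fun n hn => ?_
  have hNn : N ≤ n := not_lt.1 hn.2
  exact mem_padicE_of_add_mul_mem (by omega) (hψ n hNn) hb hn.1

section

variable (p : ℕ) [Fact p.Prime] [MeasurableSpace ℤ_[p]] [BorelSpace ℤ_[p]]
variable (μ : Measure ℤ_[p]) [μ.IsAddHaarMeasure] [IsProbabilityMeasure μ]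

theorem not_summable_of_tsum_measure_padicE {ψ : ℕ → ℝ} {N : ℕ} (hN : 2 ≤ N)
    (hψ0 : ∀ n, 0 ≤ ψ n) (hψ : ∀ n, N ≤ n → ψ n < 1) {k : ℕ → ℕ}
    (hk : ∀ n, N ≤ n → 0 < ψ n → ψ n ≤ p * ((p ^ k n : ℕ) : ℝ)⁻¹)
    (hdiv : ∑' n : ℕ, μ (padicE p ψ n) = ⊤) :
    ¬ Summable ({n | N ≤ n ∧ p.Coprime n ∧ 0 < ψ n}.indicator
      fun n => (n.totient : ℝ) * ((p ^ k n : ℕ) : ℝ)⁻¹) := by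
  intro hs
  set S : Set ℕ := {n | N ≤ n ∧ p.Coprime n ∧ 0 < ψ n} with hS
  set f : ℕ → ℝ := S.indicator fun n => (n.totient : ℝ) * ((p ^ k n : ℕ) : ℝ)⁻¹ with hf
  set g : ℕ → ℝ := fun n => (if n < N then 1 else 0) + 2 * p * f n with hg
  have hp1 : 1 < p := (Fact.out : p.Prime).one_lt
  have hf0 : ∀ n, 0 ≤ f n := fun n => Set.indicator_nonneg (fun _ _ => by positivity) n
  have hgs : Summable g := by
    refine Summable.add (summable_of_ne_finset_zero (s := Finset.range N) fun n hn => ?_)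
      (hs.mul_left _)
    rw [if_neg (by simpa using hn)]
  have hle : ∀ n, μ (padicE p ψ n) ≤ ENNReal.ofReal (g n) := by
    intro n
    rw [← ofReal_measureReal (measure_ne_top μ _)]
    refine ENNReal.ofReal_le_ofReal ?_
    have h2 : 0 ≤ 2 * (p : ℝ) * f n := by have := hf0 n; positivity
    by_cases hn : n < N
    · simp only [hg, if_pos hn]
      have h1 : μ.real (padicE p ψ n) ≤ 1 := measureReal_le_one
      linarith
    simp only [hg, if_neg hn, zero_add]
    rw [not_lt] at hn
    by_cases hpn : p ∣ n
    · rw [padicE_eq_empty (by omega) (hψ n hn) hpn, measureReal_empty]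
      exact h2
    have hcop := (Nat.Prime.coprime_iff_not_dvd Fact.out).2 hpn
    rcases (hψ0 n).eq_or_lt with h0 | h0
    · rw [measure_padicE_eq_zero p μ (by omega) hcop h0.symm]
      exact h2
    have hfn : f n = n.totient * ((p ^ k n : ℕ) : ℝ)⁻¹ := 
      Set.indicator_of_mem (s := S) ⟨hn, hcop, h0⟩ _
    have hk' := hk n hn h0
    rw [hfn]
    rcases Nat.eq_zero_or_pos (k n) with hk0 | hk0
    · have h1 : μ.real (padicE p ψ n) ≤ 2 * (n.totient * ((p ^ 0 : ℕ) : ℝ)⁻¹) :=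
        measure_padicE_le p μ (by omega) hcop (by simpa using (hψ n hn).le)
      refine h1.trans ?_
      rw [hk0, mul_assoc]
      have h3 : (1 : ℝ) ≤ p := by exact_mod_cast hp1.le
      have h4 : (0 : ℝ) ≤ n.totient * ((p ^ 0 : ℕ) : ℝ)⁻¹ := by positivity
      nlinarith
    · obtain ⟨m, hm⟩ := Nat.exists_eq_add_of_le' hk0
      have hpm : (p : ℝ) * ((p ^ k n : ℕ) : ℝ)⁻¹ = ((p ^ m : ℕ) : ℝ)⁻¹ := by
        rw [hm, Nat.pow_succ]
        push_cast
        field_simp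
      refine (measure_padicE_le p μ (by omega) hcop (hk'.trans_eq hpm)).trans_eq ?_
      rw [← hpm]
      ring
  have hfin : ∑' n : ℕ, μ (padicE p ψ n) ≠ ⊤ :=
    ne_top_of_le_ne_top hgs.tsum_ofReal_ne_top (ENNReal.tsum_le_tsum hle)
  exact hfin hdiv

theorem measure_iInter_padicW_ne_zero {ψ : ℕ → ℝ} {S : Set ℕ} {k : ℕ → ℕ} {C : ℝ}
    (hC0 : 0 ≤ C) (hψ0 : ∀ n, 0 ≤ ψ n) (hS0 : ∀ n ∈ S, n ≠ 0) (hp : ∀ n ∈ S, p.Coprime n)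
    (hC : ∀ n ∈ S, (n : ℝ) ^ 2 ≤ C * (p ^ k n : ℕ)) (hle : ∀ n ∈ S, n ≤ p ^ k n)
    (hψ : ∀ n ∈ S, ((p ^ k n : ℕ) : ℝ)⁻¹ ≤ ψ n)
    (hdiv : ¬ Summable (S.indicator fun n => (n.totient : ℝ) * ((p ^ k n : ℕ) : ℝ)⁻¹)) :
    μ (⋂ j : ℕ, padicW p (fun n => ψ n / p ^ j)) ≠ 0 := by
  have hp1 : 1 < p := (Fact.out : p.Prime).one_lt
  have hp1' : (1 : ℝ) ≤ p := by exact_mod_cast hp1.le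
  have hp0 : (0 : ℝ) < p := by linarith
  have hanti : Antitone fun j : ℕ => padicW p (fun n => ψ n / p ^ j) := by
    intro i j hij
    refine padicW_mono p fun n => ?_
    exact div_le_div_of_nonneg_left (hψ0 n) (by positivity) (pow_le_pow_right₀ hp1' hij)
  rw [hanti.measure_iInter (fun j => (measurableSet_padicW p _).nullMeasurableSet)
    ⟨0, measure_ne_top _ _⟩]
  have hpow : ∀ n j, p ^ k n ≤ p ^ (k n + j) := fun n j =>
    Nat.pow_le_pow_right hp1.le (by omega)
  have hmain : ENNReal.ofReal (1 + 6 * Real.exp 4 + 2 * overlapConst C)⁻¹ ≤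
      ⨅ j : ℕ, μ (padicW p (fun n => ψ n / p ^ j)) := by
    refine le_iInf fun j => le_measure_padicW p μ (k := fun n => k n + j) hC0 hS0 hp
      (fun n hn => (hC n hn).trans ?_) (fun n hn => (hle n hn).trans (hpow n j))
      (fun n hn => ?_) fun hs => hdiv ?_
    · exact mul_le_mul_of_nonneg_left (by exact_mod_cast hpow n j) hC0
    · have h1 : ((p ^ (k n + j) : ℕ) : ℝ)⁻¹ = ((p ^ k n : ℕ) : ℝ)⁻¹ / p ^ j := by
        push_cast
        rw [pow_add, mul_inv, div_eq_mul_inv]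
      rw [h1]
      exact div_le_div_of_nonneg_right (hψ n hn) (by positivity)
    · refine (hs.mul_left ((p : ℝ) ^ j)).congr fun n => ?_
      by_cases hn : n ∈ S
      · rw [Set.indicator_of_mem hn, Set.indicator_of_mem hn]
        push_cast
        rw [pow_add]
        field_simp
      · rw [Set.indicator_of_notMem hn, Set.indicator_of_notMem hn, mul_zero]
  refine (lt_of_lt_of_le ?_ hmain).ne'
  have h1 : 0 ≤ overlapConst C := by
    unfold overlapConst
    have := sparseConst_pos
    positivity
  have h2 := Real.exp_pos 4
  rw [ENNReal.ofReal_pos]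
  positivity

end

/-- **Theorem 4(iv) (Haynes).** Let `p` be prime and `ψ` non-negative with
`Σ μ_p(E_n(ψ)) = ∞`.  If `ψ(n) ≤ C·n⁻²` for some constant `C > 0` and all `n ≥ 1`,
then `μ_p(W_p(ψ)) = 1`. -/
theorem stmt6 (p : ℕ) [Fact p.Prime] [MeasurableSpace ℤ_[p]] [BorelSpace ℤ_[p]]
    (μ : Measure ℤ_[p]) [μ.IsAddHaarMeasure] [IsProbabilityMeasure μ]
    (ψ : ℕ → ℝ) (hψ : ∀ n, 0 ≤ ψ n)
    (hdiv : ∑' n : ℕ, μ (padicE p ψ n) = ⊤)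
    (hbound : ∃ C : ℝ, 0 < C ∧ ∀ n : ℕ, 0 < n → ψ n ≤ C / (n : ℝ) ^ 2) :
    μ (padicW p ψ) = 1 := by
  obtain ⟨C, hC0, hC⟩ := hbound
  obtain ⟨N, hN2, hNC⟩ : ∃ N : ℕ, 2 ≤ N ∧ C ≤ N :=
    ⟨max 2 ⌈C⌉₊, le_max_left _ _, (Nat.le_ceil C).trans (by exact_mod_cast le_max_right _ _)⟩
  have hψn : ∀ n, N ≤ n → ψ n ≤ (n : ℝ)⁻¹ := by
    intro n hn
    have hn0 : (0 : ℝ) < n := by exact_mod_cast (by omega : 0 < n)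
    refine (hC n (by omega)).trans ?_
    rw [div_le_iff₀ (by positivity)]
    have h1 : (n : ℝ)⁻¹ * (n : ℝ) ^ 2 = n := by field_simp
    rw [h1]
    exact hNC.trans (by exact_mod_cast hn)
  have hψ1 : ∀ n, N ≤ n → ψ n < 1 := fun n hn =>
    (hψn n hn).trans_lt (inv_lt_one_of_one_lt₀ (by exact_mod_cast (by omega : 1 < n)))
  have hex : ∀ n, ∃ k : ℕ, N ≤ n → 0 < ψ n →
      ((p ^ k : ℕ) : ℝ)⁻¹ < ψ n ∧ ψ n ≤ p * ((p ^ k : ℕ) : ℝ)⁻¹ := by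
    intro n
    by_cases h : N ≤ n ∧ 0 < ψ n
    · obtain ⟨k, hk⟩ := exists_pow_inv_lt_le (Fact.out : p.Prime) h.2 (hψ1 n h.1).le
      exact ⟨k, fun _ _ => hk⟩
    · exact ⟨0, fun h1 h2 => absurd ⟨h1, h2⟩ h⟩
  choose k hk using hex
  have hpk : ∀ n, (0 : ℝ) < (p ^ k n : ℕ) := fun n => by
    exact_mod_cast pow_pos (Fact.out : p.Prime).pos _
  have hne : μ (⋂ j : ℕ, padicW p (fun n => ψ n / p ^ j)) ≠ 0 := by
    refine measure_iInter_padicW_ne_zero p μ (S := {n | N ≤ n ∧ p.Coprime n ∧ 0 < ψ n}) (k := k)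
      hC0.le hψ (fun n hn => ?_) (fun n hn => hn.2.1) (fun n hn => ?_) (fun n hn => ?_)
      (fun n hn => (hk n hn.1 hn.2.2).1.le)
      (not_summable_of_tsum_measure_padicE p μ hN2 hψ hψ1 (fun n h1 h2 => (hk n h1 h2).2) hdiv)
    · have := hn.1
      omega
    · have hn0 : (0 : ℝ) < n := by exact_mod_cast (by have := hn.1; omega : 0 < n)
      have h1 := (hk n hn.1 hn.2.2).1.le.trans (hC n (by exact_mod_cast hn0))
      rw [inv_le_iff_one_le_mul₀ (hpk n), div_mul_eq_mul_div, le_div_iff₀ (by positivity),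
        one_mul] at h1
      exact h1
    · have hn0 : (0 : ℝ) < n := by exact_mod_cast (by have := hn.1; omega : 0 < n)
      have h1 := (hk n hn.1 hn.2.2).1.le.trans (hψn n hn.1)
      rw [inv_le_inv₀ (hpk n) hn0] at h1
      exact_mod_cast h1
  have hone := measure_eq_one_of_selfSimilar p μ hne fun i b hb y hy =>
    mem_iInter_padicW_of_add_mul_mem (by omega) (fun n hn => (hψ1 n hn).le) hb hy
  refine le_antisymm prob_le_one ?_
  rw [← hone]
  refine measure_mono ((Set.iInter_subset _ 0).trans (padicW_mono p fun n => ?_))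
  simp
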